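/- arXiv:math/0501493 — 5 statements merged into one kernel-verified Lean document; each statement's English description precedes it below -/
import Mathlib

section
/- Define g_3 : ℝ → ℝ by g_3(t) = 1 + 1.6·P_1(t) + 3.48·P_2(t) + 1.65·P_3(t) + 1.96·P_4(t) + 0.1·P_5(t) + 0.32·P_9(t), where P_k denotes the degree-k Legendre polynomial, and define ĝ_3 : [-1,1] → ℝ by ĝ_3(t) = min(-(1/2.89)·g_3(t), 0) for t ≤ 1/2 and ĝ_3(t) = 2t - 1 for t > 1/2. Then for every N ≥ 0 and every sequence x_0, x_1, …, x_N of unit vectors in ℝ^3 with ⟨x_i, x_j⟩ ≤ 1/2 for all 0 ≤ i < j ≤ N, one has ∑_{i=0}^N ĝ_3(⟨x_0, x_i⟩) ≥ 0. -/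
open scoped RealInnerProductSpace BigOperators

/-- The Legendre polynomials `P_k`, defined by the three-term recurrence
`P₀ = 1`, `P₁ = t`, `(k+2) P_{k+2}(t) = (2k+3) t P_{k+1}(t) - (k+1) P_k(t)`. -/
noncomputable def legendreP : ℕ → ℝ → ℝ
  | 0, _ => 1
  | 1, t => t
  | (k + 2), t =>
      ((2 * (k : ℝ) + 3) * t * legendreP (k + 1) t - ((k : ℝ) + 1) * legendreP k t)
        / ((k : ℝ) + 2)

/-- The polynomial `g₃` of Musin, expressed via Legendre polynomials
`P_k = G_k^{(3)}`. -/
noncomputable def gThree (t : ℝ) : ℝ :=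
  1 + 1.6 * legendreP 1 t + 3.48 * legendreP 2 t + 1.65 * legendreP 3 t
    + 1.96 * legendreP 4 t + 0.1 * legendreP 5 t + 0.32 * legendreP 9 t

/-- The modified function `ĝ₃`. -/
noncomputable def gThreeHat (t : ℝ) : ℝ :=
  if t ≤ 1 / 2 then min (-(1 / 2.89) * gThree t) 0 else 2 * t - 1

open Finset

/-! ### The polynomial `s ↦ g₃(-s)` -/

/-- The polynomial `s ↦ g₃(-s)` in the monomial basis. -/
noncomputable def gThreeNeg (s : ℝ) : ℝ :=
  -(1 / 200) - 1 / 10 * s - 213 / 100 * s ^ 2 + 83 / 10 * s ^ 3 + 343 / 40 * s ^ 4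
    - 18333 / 400 * s ^ 5 + 1287 / 20 * s ^ 7 - 2431 / 80 * s ^ 9

lemma gThree_neg (s : ℝ) : gThree (-s) = gThreeNeg s := by
  simp only [gThree, gThreeNeg, legendreP]
  push_cast
  ring

/-- A degree nine polynomial is nonnegative on `[a, b]` as soon as it is a nonnegative
combination of the Bernstein polynomials of `[a, b]`; this lemma supplies their signs. -/
lemma sub_pow_mul_sub_pow_nonneg {a b s : ℝ} (ha : a ≤ s) (hb : s ≤ b) (j k : ℕ) :
    0 ≤ (s - a) ^ j * (b - s) ^ k :=
  mul_nonneg (pow_nonneg (sub_nonneg.2 ha) j) (pow_nonneg (sub_nonneg.2 hb) k)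

lemma gThreeNeg_nonpos {s : ℝ} (h₁ : -(1 / 2) ≤ s) (h₂ : s ≤ 59 / 100) : gThreeNeg s ≤ 0 := by
  unfold gThreeNeg
  rcases le_total s (-(1 / 50)) with h | h
  · have B := sub_pow_mul_sub_pow_nonneg h₁ h
    linarith [B 0 9, B 1 8, B 2 7, B 3 6, B 4 5, B 5 4, B 6 3, B 7 2, B 8 1, B 9 0]
  rcases le_total s (47 / 100) with h' | h'
  · have B := sub_pow_mul_sub_pow_nonneg h h'
    linarith [B 0 9, B 1 8, B 2 7, B 3 6, B 4 5, B 5 4, B 6 3, B 7 2, B 8 1, B 9 0]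
  · have B := sub_pow_mul_sub_pow_nonneg h' h₂
    linarith [B 0 9, B 1 8, B 2 7, B 3 6, B 4 5, B 5 4, B 6 3, B 7 2, B 8 1, B 9 0]

lemma monotoneOn_gThreeNeg : MonotoneOn gThreeNeg (Set.Icc (59 / 100) 1) := by
  have hd : ∀ s, HasDerivAt gThreeNeg (-(1 / 10) - 213 / 50 * s + 249 / 10 * s ^ 2
      + 343 / 10 * s ^ 3 - 18333 / 80 * s ^ 4 + 9009 / 20 * s ^ 6 - 21879 / 80 * s ^ 8) s := by
    intro s
    have h : ∀ n : ℕ, HasDerivAt (fun x : ℝ ↦ x ^ n) (n * s ^ (n - 1)) s := fun n ↦ hasDerivAt_pow n s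
    have := (((((((hasDerivAt_const s (-(1 / 200) : ℝ)).sub
      ((hasDerivAt_id' s).const_mul (1 / 10))).sub ((h 2).const_mul (213 / 100))).add
      ((h 3).const_mul (83 / 10))).add ((h 4).const_mul (343 / 40))).sub
      ((h 5).const_mul (18333 / 400))).add ((h 7).const_mul (1287 / 20))).sub
      ((h 9).const_mul (2431 / 80))
    refine this.congr_deriv ?_
    norm_num
    ring
  refine monotoneOn_of_deriv_nonneg (convex_Icc _ _)
    (fun s _ ↦ (hd s).continuousAt.continuousWithinAt)
    (fun s _ ↦ (hd s).differentiableAt.differentiableWithinAt) fun s hs ↦ ?_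
  rw [(hd s).deriv]
  have B := sub_pow_mul_sub_pow_nonneg (interior_subset hs).1 (interior_subset hs).2
  linarith [B 0 8, B 1 7, B 2 6, B 3 5, B 4 4, B 5 3, B 6 2, B 7 1, B 8 0]

lemma gThreeNeg_le_quadratic {s : ℝ} (h₁ : 16 / 25 ≤ s) (h₂ : s ≤ 1) :
    gThreeNeg s ≤ 7.788 - 25.55 * s + 21 * s ^ 2 := by
  unfold gThreeNeg
  rcases le_total s (9 / 10) with h | h
  · have B := sub_pow_mul_sub_pow_nonneg h₁ h
    linarith [B 0 9, B 1 8, B 2 7, B 3 6, B 4 5, B 5 4, B 6 3, B 7 2, B 8 1, B 9 0]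
  · have B := sub_pow_mul_sub_pow_nonneg h h₂
    linarith [B 0 9, B 1 8, B 2 7, B 3 6, B 4 5, B 5 4, B 6 3, B 7 2, B 8 1, B 9 0]

lemma gThreeNeg_le_linear {s : ℝ} (h₁ : 16 / 25 ≤ s) (h₂ : s ≤ 1) :
    gThreeNeg s ≤ 7.77 * s - 4.937 := by
  unfold gThreeNeg
  rcases le_total s (97 / 100) with h | h
  · have B := sub_pow_mul_sub_pow_nonneg h₁ h
    linarith [B 0 9, B 1 8, B 2 7, B 3 6, B 4 5, B 5 4, B 6 3, B 7 2, B 8 1, B 9 0]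
  · have B := sub_pow_mul_sub_pow_nonneg h h₂
    linarith [B 0 9, B 1 8, B 2 7, B 3 6, B 4 5, B 5 4, B 6 3, B 7 2, B 8 1, B 9 0]

lemma gThreeNeg_le_linear' {s : ℝ} (h₁ : 67 / 100 ≤ s) (h₂ : s ≤ 1) :
    gThreeNeg s ≤ 8.38 * s - 5.532 := by
  unfold gThreeNeg
  rcases le_total s (97 / 100) with h | h
  · have B := sub_pow_mul_sub_pow_nonneg h₁ h
    linarith [B 0 9, B 1 8, B 2 7, B 3 6, B 4 5, B 5 4, B 6 3, B 7 2, B 8 1, B 9 0]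
  · have B := sub_pow_mul_sub_pow_nonneg h h₂
    linarith [B 0 9, B 1 8, B 2 7, B 3 6, B 4 5, B 5 4, B 6 3, B 7 2, B 8 1, B 9 0]

/-- The bound for two points at mutual distance exactly `60°`, on a great circle through the
centre of the cap: there `g₃(-s) + g₃(-t)` is a polynomial in `s + t`. -/
lemma gThreeNeg_add_le_of_eq {s t : ℝ} (hs : 59 / 100 ≤ s) (hs' : s ≤ 1) (ht : 59 / 100 ≤ t)
    (ht' : t ≤ 1) (h : s ^ 2 + t ^ 2 - s * t = 3 / 4) :
    gThreeNeg s + gThreeNeg t ≤ 2.771 := by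
  obtain ⟨σ, hσ⟩ : ∃ σ, σ = s + t := ⟨_, rfl⟩
  obtain ⟨δ, hδ⟩ : ∃ δ, δ = s - t := ⟨_, rfl⟩
  obtain rfl : s = (σ + δ) / 2 := by linarith
  obtain rfl : t = (σ - δ) / 2 := by linarith
  have hsq : δ ^ 2 = 1 - σ ^ 2 / 3 := by linarith
  have h₁ : 3 / 2 ≤ σ := by nlinarith
  have h₂ : σ ≤ 17321 / 10000 := by nlinarith
  have hsum : gThreeNeg ((σ + δ) / 2) + gThreeNeg ((σ - δ) / 2) =
      -(1 / 320) - 45623 / 20480 * σ + 751 / 150 * σ ^ 2 + 261 / 512 * σ ^ 3 - 343 / 360 * σ ^ 4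
        - 3873 / 6400 * σ ^ 5 + 143 / 960 * σ ^ 7 := by
    have h4 : δ ^ 4 = (1 - σ ^ 2 / 3) ^ 2 := by rw [← hsq]; ring
    have h6 : δ ^ 6 = (1 - σ ^ 2 / 3) ^ 3 := by rw [← hsq]; ring
    have h8 : δ ^ 8 = (1 - σ ^ 2 / 3) ^ 4 := by rw [← hsq]; ring
    unfold gThreeNeg
    ring_nf
    rw [hsq, h4, h6, h8]
    ring
  rw [hsum]
  have B := sub_pow_mul_sub_pow_nonneg h₁ h₂
  linarith [B 0 7, B 1 6, B 2 5, B 3 4, B 4 3, B 5 2, B 6 1, B 7 0]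

lemma gThreeNeg_add_le {s t : ℝ} (hs : 59 / 100 ≤ s) (hs' : s ≤ 1) (ht : 59 / 100 ≤ t)
    (h : s ^ 2 + t ^ 2 - s * t ≤ 3 / 4) :
    gThreeNeg s + gThreeNeg t ≤ 2.771 := by
  set r := √(3 - 3 * s ^ 2)
  have hr : r ^ 2 = 3 - 3 * s ^ 2 := Real.sq_sqrt (by nlinarith)
  have htr : 2 * t - s ≤ r := Real.le_sqrt_of_sq_le (by nlinarith)
  have heq : s ^ 2 + ((s + r) / 2) ^ 2 - s * ((s + r) / 2) = 3 / 4 := by linarith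
  have hle : (s + r) / 2 ≤ 1 := by nlinarith [sq_nonneg (s - (s + r) / 4)]
  have htr' : t ≤ (s + r) / 2 := by linarith
  have hmono := monotoneOn_gThreeNeg ⟨ht, htr'.trans hle⟩ ⟨ht.trans htr', hle⟩ htr'
  linarith [gThreeNeg_add_le_of_eq hs hs' (ht.trans htr') hle heq]

/-! ### Points in a spherical cap at mutual distance at least `60°` -/

section Cap

variable {ι V : Type*} [NormedAddCommGroup V] [InnerProductSpace ℝ V]

/-- The points `y i`, `i ∈ T`, lie on the unit sphere, are at mutual angular distance at least
`60°`, and have height more than `59 / 100` in the direction of the unit vector `e`. -/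
structure IsCapCode (e : V) (y : ι → V) (T : Finset ι) : Prop where
  norm_pole : ‖e‖ = 1
  norm_eq : ∀ i ∈ T, ‖y i‖ = 1
  inner_le : ∀ i ∈ T, ∀ j ∈ T, i ≠ j → ⟪y i, y j⟫ ≤ 1 / 2
  lt_inner : ∀ i ∈ T, 59 / 100 < ⟪e, y i⟫

namespace IsCapCode

variable {e : V} {y : ι → V} {T : Finset ι}

lemma subset (h : IsCapCode e y T) {U : Finset ι} (hU : U ⊆ T) : IsCapCode e y U where
  norm_pole := h.norm_pole
  norm_eq i hi := h.norm_eq i (hU hi)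
  inner_le i hi j hj := h.inner_le i (hU hi) j (hU hj)
  lt_inner i hi := h.lt_inner i (hU hi)

lemma inner_le_one (h : IsCapCode e y T) {i : ι} (hi : i ∈ T) : ⟪e, y i⟫ ≤ 1 := by
  have := real_inner_le_norm e (y i)
  rwa [h.norm_pole, h.norm_eq i hi, one_mul] at this

/-- Cauchy–Schwarz for the vector `∑ w i • y i`. -/
lemma sq_sum_mul_inner_le (h : IsCapCode e y T) {w : ι → ℝ} (hw : ∀ i ∈ T, 0 ≤ w i) :
    (∑ i ∈ T, w i * ⟪e, y i⟫) ^ 2 ≤ ((∑ i ∈ T, w i ^ 2) + (∑ i ∈ T, w i) ^ 2) / 2 := by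
  classical
  have h₁ : (∑ i ∈ T, w i * ⟪e, y i⟫) ^ 2 ≤ ‖∑ i ∈ T, w i • y i‖ ^ 2 := by
    have := abs_real_inner_le_norm e (∑ i ∈ T, w i • y i)
    rw [h.norm_pole, one_mul] at this
    simp only [inner_sum, real_inner_smul_right] at this
    exact sq_le_sq.2 (this.trans (le_abs_self _))
  have h₂ : ‖∑ i ∈ T, w i • y i‖ ^ 2 =
      ∑ i ∈ T, ∑ j ∈ T, w i * w j * ⟪y i, y j⟫ := by
    rw [← real_inner_self_eq_norm_sq, sum_inner]
    refine sum_congr rfl fun i _ ↦ ?_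
    rw [inner_sum]
    refine sum_congr rfl fun j _ ↦ ?_
    rw [real_inner_smul_left, real_inner_smul_right, mul_assoc]
  have h₃ : ∀ i ∈ T, ∀ j ∈ T, w i * w j * ⟪y i, y j⟫ ≤
      w i * w j / 2 + if i = j then w i ^ 2 / 2 else 0 := by
    intro i hi j hj
    split_ifs with hij
    · subst hij
      rw [real_inner_self_eq_norm_sq, h.norm_eq i hi]
      linarith
    · have := mul_le_mul_of_nonneg_left (h.inner_le i hi j hj hij) (mul_nonneg (hw i hi) (hw j hj))
      linarith
  calc _ ≤ _ := h₁
    _ = _ := h₂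
    _ ≤ ∑ i ∈ T, ∑ j ∈ T, (w i * w j / 2 + if i = j then w i ^ 2 / 2 else 0) :=
      sum_le_sum fun i hi ↦ sum_le_sum fun j hj ↦ h₃ i hi j hj
    _ = _ := by
      have : ∀ i ∈ T, ∑ j ∈ T, (w i * w j / 2 + if i = j then w i ^ 2 / 2 else 0) =
          w i * (∑ j ∈ T, w j) / 2 + w i ^ 2 / 2 := by
        intro i hi
        rw [sum_add_distrib, sum_ite_eq, if_pos hi, ← sum_div, mul_sum]
      rw [sum_congr rfl this, sum_add_distrib, ← sum_div, ← sum_div, ← sum_mul]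
      ring

lemma sq_sum_inner_le (h : IsCapCode e y T) :
    (∑ i ∈ T, ⟪e, y i⟫) ^ 2 ≤ (#T + (#T : ℝ) ^ 2) / 2 := by
  simpa using h.sq_sum_mul_inner_le (w := fun _ ↦ 1) fun _ _ ↦ zero_le_one

lemma sum_inner_sq_le (h : IsCapCode e y T)
    (hw : ∀ i ∈ T, (∑ j ∈ T, ⟪e, y j⟫) / (#T + 1) ≤ ⟪e, y i⟫) :
    ∑ i ∈ T, ⟪e, y i⟫ ^ 2 ≤ 1 / 2 + (∑ i ∈ T, ⟪e, y i⟫) ^ 2 / (#T + 1) := by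
  have key := h.sq_sum_mul_inner_le
    (w := fun i ↦ ⟪e, y i⟫ - (∑ j ∈ T, ⟪e, y j⟫) / (#T + 1)) fun i hi ↦ sub_nonneg.2 (hw i hi)
  set S := ∑ j ∈ T, ⟪e, y j⟫ with hS
  set A := ∑ i ∈ T, ⟪e, y i⟫ ^ 2 with hA
  have hm : (0 : ℝ) < #T + 1 := by positivity
  obtain ⟨c, hc⟩ : ∃ c, c = S / (#T + 1 : ℝ) := ⟨_, rfl⟩
  have hcS : c * (#T + 1) = S := by rw [hc]; field_simp
  rw [← hc] at key
  have e₁ : ∑ i ∈ T, (⟪e, y i⟫ - c) * ⟪e, y i⟫ = A - c * S := by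
    rw [hA, hS, mul_sum, ← sum_sub_distrib]
    exact sum_congr rfl fun i _ ↦ by ring
  have e₂ : ∑ i ∈ T, (⟪e, y i⟫ - c) ^ 2 = A - 2 * c * S + #T * c ^ 2 := by
    rw [hA, hS, mul_sum, ← sum_sub_distrib, ← nsmul_eq_mul, ← sum_const, ← sum_add_distrib]
    exact sum_congr rfl fun i _ ↦ by ring
  have e₃ : ∑ i ∈ T, (⟪e, y i⟫ - c) = c := by
    rw [sum_sub_distrib, sum_const, nsmul_eq_mul, ← hS]
    linarith
  rw [e₁, e₂, e₃] at key
  have e₄ : S ^ 2 / (#T + 1) = c * S := by rw [hc]; ring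
  rw [e₄]
  have e₅ : A - 2 * c * S + #T * c ^ 2 + c ^ 2 = A - c * S := by
    linear_combination c * hcS
  rw [e₅] at key
  by_contra! hlt
  nlinarith

lemma gThreeNeg_sum_le_of_card_two (h : IsCapCode e y T) (hT : #T = 2) :
    ∑ i ∈ T, gThreeNeg ⟪e, y i⟫ ≤ 2.771 := by
  classical
  obtain ⟨i, j, hij, rfl⟩ := card_eq_two.1 hT
  have hi := h.lt_inner i (by simp)
  have hj := h.lt_inner j (by simp)
  have hi' := h.inner_le_one (i := i) (by simp)
  have hj' := h.inner_le_one (i := j) (by simp)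
  have key := h.sum_inner_sq_le
  rw [hT, sum_pair hij, sum_pair hij] at key
  rw [sum_pair hij]
  refine gThreeNeg_add_le hi.le hi' hj.le ?_
  have := key fun k hk ↦ by
    rcases mem_insert.1 hk with rfl | hk
    · push_cast; linarith
    · rw [mem_singleton.1 hk]; push_cast; linarith
  push_cast at this
  linarith

lemma gThreeNeg_sum_le_of_card_le_two (h : IsCapCode e y T) (hT : #T ≤ 2) :
    ∑ i ∈ T, gThreeNeg ⟪e, y i⟫ ≤ 2.771 := by
  obtain hT | hT | hT : #T = 0 ∨ #T = 1 ∨ #T = 2 := by omega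
  · rw [card_eq_zero.1 hT, sum_empty]
    norm_num
  · obtain ⟨i, rfl⟩ := card_eq_one.1 hT
    have hi := h.lt_inner i (by simp)
    have hi' := h.inner_le_one (i := i) (by simp)
    have := monotoneOn_gThreeNeg ⟨hi.le, hi'⟩ ⟨by norm_num, le_rfl⟩ hi'
    rw [sum_singleton]
    refine this.trans ?_
    norm_num [gThreeNeg]
  · exact h.gThreeNeg_sum_le_of_card_two hT

lemma gThreeNeg_sum_le_quadratic (h : IsCapCode e y T) (hlo : ∀ i ∈ T, 16 / 25 ≤ ⟪e, y i⟫)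
    (hw : ∀ i ∈ T, (∑ j ∈ T, ⟪e, y j⟫) / (#T + 1) ≤ ⟪e, y i⟫) :
    ∑ i ∈ T, gThreeNeg ⟪e, y i⟫ ≤ 7.788 * #T - 25.55 * (∑ i ∈ T, ⟪e, y i⟫)
      + 21 * (1 / 2 + (∑ i ∈ T, ⟪e, y i⟫) ^ 2 / (#T + 1)) := by
  calc _ ≤ ∑ i ∈ T, (7.788 - 25.55 * ⟪e, y i⟫ + 21 * ⟪e, y i⟫ ^ 2) :=
        sum_le_sum fun i hi ↦ gThreeNeg_le_quadratic (hlo i hi) (h.inner_le_one hi)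
    _ = 7.788 * #T - 25.55 * (∑ i ∈ T, ⟪e, y i⟫) + 21 * ∑ i ∈ T, ⟪e, y i⟫ ^ 2 := by
      rw [sum_add_distrib, sum_sub_distrib, sum_const, nsmul_eq_mul, mul_sum, mul_sum]
      ring
    _ ≤ _ := by linarith [h.sum_inner_sq_le hw]

lemma gThreeNeg_sum_le_linear {a b : ℝ}
    (hab : ∀ i ∈ T, gThreeNeg ⟪e, y i⟫ ≤ b * ⟪e, y i⟫ - a) :
    ∑ i ∈ T, gThreeNeg ⟪e, y i⟫ ≤ b * (∑ i ∈ T, ⟪e, y i⟫) - a * #T := by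
  refine (sum_le_sum hab).trans_eq ?_
  rw [sum_sub_distrib, sum_const, nsmul_eq_mul, mul_sum]
  ring

lemma gThreeNeg_le_of_lt (h : IsCapCode e y T) {i : ι} (hi : i ∈ T) {a : ℝ} (ha : a ≤ 1)
    (hia : ⟪e, y i⟫ < a) : gThreeNeg ⟪e, y i⟫ ≤ gThreeNeg a :=
  monotoneOn_gThreeNeg ⟨(h.lt_inner i hi).le, h.inner_le_one hi⟩
    ⟨(h.lt_inner i hi).le.trans hia.le, ha⟩ hia.le

lemma gThreeNeg_sum_le_of_card_three (h : IsCapCode e y T) (hT : #T = 3) :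
    ∑ i ∈ T, gThreeNeg ⟪e, y i⟫ ≤ 2.853 := by
  classical
  by_cases hlow : ∃ i ∈ T, ⟪e, y i⟫ < 67 / 100
  · obtain ⟨i, hi, hi'⟩ := hlow
    have hcard : #(T.erase i) ≤ 2 := by rw [card_erase_of_mem hi, hT]
    have h₁ := (h.subset (erase_subset i T)).gThreeNeg_sum_le_of_card_le_two hcard
    have h₂ := h.gThreeNeg_le_of_lt hi (by norm_num) hi'
    have h₃ : gThreeNeg (67 / 100) ≤ 0.082 := by norm_num [gThreeNeg]
    rw [← add_sum_erase T _ hi]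
    linarith
  push Not at hlow
  have hS := h.sq_sum_inner_le
  have hlin := gThreeNeg_sum_le_linear (e := e) (y := y) fun i hi ↦
    gThreeNeg_le_linear' (hlow i hi) (h.inner_le_one hi)
  have hquad := h.gThreeNeg_sum_le_quadratic fun i hi ↦ by linarith [hlow i hi]
  rw [hT] at hS hlin hquad
  push_cast at hS hlin hquad
  have hS' : ∑ i ∈ T, ⟪e, y i⟫ ≤ 2.45 := abs_le_of_sq_le_sq' (by linarith) (by norm_num) |>.2
  specialize hquad fun i hi ↦ by linarith [hlow i hi]
  rcases le_total (∑ i ∈ T, ⟪e, y i⟫) 2.32 with hle | hle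
  · linarith
  · nlinarith [mul_nonneg (sub_nonneg.2 hle) (sub_nonneg.2 hS')]

lemma gThreeNeg_sum_le_of_card_four (h : IsCapCode e y T) (hT : #T = 4) :
    ∑ i ∈ T, gThreeNeg ⟪e, y i⟫ ≤ 2.89 := by
  classical
  by_cases hlow : ∃ i ∈ T, ⟪e, y i⟫ < 16 / 25
  · obtain ⟨i, hi, hi'⟩ := hlow
    have hcard : #(T.erase i) = 3 := by rw [card_erase_of_mem hi, hT]
    have h₁ := (h.subset (erase_subset i T)).gThreeNeg_sum_le_of_card_three hcard
    have h₂ := h.gThreeNeg_le_of_lt hi (by norm_num) hi'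
    have h₃ : gThreeNeg (16 / 25) ≤ 0.035 := by norm_num [gThreeNeg]
    rw [← add_sum_erase T _ hi]
    linarith
  push Not at hlow
  have hS := h.sq_sum_inner_le
  have hlin := gThreeNeg_sum_le_linear (e := e) (y := y) fun i hi ↦
    gThreeNeg_le_linear (hlow i hi) (h.inner_le_one hi)
  have hquad := h.gThreeNeg_sum_le_quadratic hlow
  rw [hT] at hS hlin hquad
  push_cast at hS hlin hquad
  have hS' : ∑ i ∈ T, ⟪e, y i⟫ ≤ 3.163 := abs_le_of_sq_le_sq' (by linarith) (by norm_num) |>.2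
  specialize hquad fun i hi ↦ by linarith [hlow i hi]
  rcases le_total (∑ i ∈ T, ⟪e, y i⟫) 2.913 with hle | hle
  · linarith
  · nlinarith [mul_nonneg (sub_nonneg.2 hle) (sub_nonneg.2 hS')]

end IsCapCode

end Cap

/-! ### At most four points -/

/-- A unit circle contains at most four points with pairwise inner products at most `0.24`. The
proof is the linear programming bound with the polynomial `(x - 0.24) (x + 0.8) ^ 2`. -/
lemma card_le_four_of_unit_circle {ι : Type*} {T : Finset ι} {c d : ι → ℝ}
    (hcd : ∀ i ∈ T, c i ^ 2 + d i ^ 2 = 1)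
    (hsep : ∀ i ∈ T, ∀ j ∈ T, i ≠ j → c i * c j + d i * d j ≤ 0.24) : #T ≤ 4 := by
  classical
  have hpos : ∀ f : ι → ℝ, 0 ≤ ∑ i ∈ T, ∑ j ∈ T, f i * f j := fun f ↦ by
    rw [← sum_mul_sum]
    exact mul_self_nonneg _
  have hexpand : ∀ i ∈ T, ∀ j ∈ T,
      (c i * c j + d i * d j - 0.24) * (c i * c j + d i * d j + 0.8) ^ 2 = 0.5264
        + 1.006 * (c i * c j + d i * d j)
        + 0.68 * ((c i ^ 2 - d i ^ 2) * (c j ^ 2 - d j ^ 2) + 2 * c i * d i * (2 * c j * d j))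
        + 0.25 * ((c i ^ 3 - 3 * c i * d i ^ 2) * (c j ^ 3 - 3 * c j * d j ^ 2)
          + (3 * c i ^ 2 * d i - d i ^ 3) * (3 * c j ^ 2 * d j - d j ^ 3)) := by
    intro i hi j hj
    have h₁ := hcd i hi
    have h₂ := hcd j hj
    have hprod : (c i ^ 2 + d i ^ 2) * (c j ^ 2 + d j ^ 2) = 1 := by rw [h₁, h₂, one_mul]
    linear_combination (0.68 + 0.75 * (c i * c j + d i * d j)) * hprod
  have hlower : (0.5264 : ℝ) * #T ^ 2 ≤
      ∑ i ∈ T, ∑ j ∈ T, (c i * c j + d i * d j - 0.24) * (c i * c j + d i * d j + 0.8) ^ 2 := by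
    rw [sum_congr rfl fun i hi ↦ sum_congr rfl (hexpand i hi)]
    simp only [sum_add_distrib, ← mul_sum, sum_const, nsmul_eq_mul]
    have h₁ := hpos c
    have h₂ := hpos d
    have h₃ := hpos fun i ↦ c i ^ 2 - d i ^ 2
    have h₄ := hpos fun i ↦ 2 * c i * d i
    have h₅ := hpos fun i ↦ c i ^ 3 - 3 * c i * d i ^ 2
    have h₆ := hpos fun i ↦ 3 * c i ^ 2 * d i - d i ^ 3
    simp only [← mul_sum] at h₁ h₂ h₃ h₄ h₅ h₆
    linarith
  have hupper : ∑ i ∈ T, ∑ j ∈ T,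
      (c i * c j + d i * d j - 0.24) * (c i * c j + d i * d j + 0.8) ^ 2 ≤
        ∑ i ∈ T, ∑ j ∈ T, if i = j then (2.4624 : ℝ) else 0 := by
    refine sum_le_sum fun i hi ↦ sum_le_sum fun j hj ↦ ?_
    split_ifs with hij
    · subst hij
      rw [← sq, ← sq, hcd i hi]
      norm_num
    · exact mul_nonpos_of_nonpos_of_nonneg (by linarith [hsep i hi j hj hij]) (sq_nonneg _)
  have hdiag : ∑ i ∈ T, ∑ j ∈ T, (if i = j then (2.4624 : ℝ) else 0) = #T * 2.4624 := by
    rw [sum_congr rfl fun i hi ↦ (sum_ite_eq T i _).trans (if_pos hi), sum_const, nsmul_eq_mul]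
  by_contra! hlt
  have : (5 : ℝ) ≤ #T := by exact_mod_cast hlt
  nlinarith

lemma half_sub_mul_le {s t : ℝ} (hs : 59 / 100 ≤ s) (hs' : s < 1) (ht : 59 / 100 ≤ t) :
    1 / 2 - s * t ≤ 0.24 * (√(1 - s ^ 2) * √(1 - t ^ 2)) := by
  rw [← Real.sqrt_mul (by nlinarith)]
  rcases le_total (1 / 2) (s * t) with h | h
  · have := Real.sqrt_nonneg ((1 - s ^ 2) * (1 - t ^ 2))
    linarith
  · have hp : (59 / 100) ^ 2 ≤ s * t := by nlinarith
    have hsum : s + t ≤ (s * t + 3481 / 10000) * (100 / 59) := by nlinarith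
    have hsq : (s + t) ^ 2 ≤ ((s * t + 3481 / 10000) * (100 / 59)) ^ 2 :=
      pow_le_pow_left₀ (by linarith) hsum 2
    have : (1 / 2 - s * t) * (25 / 6) ≤ √((1 - s ^ 2) * (1 - t ^ 2)) := by
      refine Real.le_sqrt_of_sq_le ?_
      have hexp : (1 - s ^ 2) * (1 - t ^ 2) = (1 + s * t) ^ 2 - (s + t) ^ 2 := by ring
      rw [hexp]
      generalize s * t = p at *
      nlinarith [mul_nonneg (sub_nonneg.2 hp) (sub_nonneg.2 h)]
    linarith

lemma IsCapCode.card_le_four {ι : Type*} {e : EuclideanSpace ℝ (Fin 3)}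
    {y : ι → EuclideanSpace ℝ (Fin 3)} {T : Finset ι} (h : IsCapCode e y T) : #T ≤ 4 := by
  classical
  by_contra! hcard
  obtain ⟨b, hb⟩ : ∃ b : OrthonormalBasis (Fin 3) ℝ (EuclideanSpace ℝ (Fin 3)), b 0 = e := by
    have hv : Orthonormal ℝ (({0} : Set (Fin 3)).domRestrict fun _ ↦ e) := by
      refine ⟨fun _ ↦ h.norm_pole, fun i j hij ↦ (hij (Subsingleton.elim i j)).elim⟩
    obtain ⟨b, hb⟩ := hv.exists_orthonormalBasis_extension_of_card_eq (by simp)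
    exact ⟨b, hb 0 rfl⟩
  have hinner : ∀ u v : EuclideanSpace ℝ (Fin 3),
      ⟪u, v⟫ = ⟪e, u⟫ * ⟪e, v⟫ + ⟪b 1, u⟫ * ⟪b 1, v⟫ + ⟪b 2, u⟫ * ⟪b 2, v⟫ := by
    intro u v
    rw [← b.sum_inner_mul_inner u v, Fin.sum_univ_three, hb]
    simp only [real_inner_comm]
  have hunit : ∀ i ∈ T, ⟪b 1, y i⟫ ^ 2 + ⟪b 2, y i⟫ ^ 2 = 1 - ⟪e, y i⟫ ^ 2 := by
    intro i hi
    have := hinner (y i) (y i)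
    rw [real_inner_self_eq_norm_sq, h.norm_eq i hi] at this
    linarith
  have hlt : ∀ i ∈ T, ⟪e, y i⟫ < 1 := by
    intro i hi
    refine lt_of_le_of_ne (h.inner_le_one hi) fun heq ↦ ?_
    obtain ⟨j, hj, hji⟩ := exists_mem_ne (by omega : 1 < #T) i
    have hei : e = y i := (inner_eq_one_iff_of_norm_eq_one h.norm_pole (h.norm_eq i hi)).1 heq
    have h₁ := h.lt_inner j hj
    have h₂ := h.inner_le i hi j hj hji.symm
    rw [hei] at h₁
    linarith
  have hr : ∀ i ∈ T, 0 < √(1 - ⟪e, y i⟫ ^ 2) := fun i hi ↦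
    Real.sqrt_pos.2 (by nlinarith [hlt i hi, h.lt_inner i hi])
  refine hcard.not_ge (card_le_four_of_unit_circle
    (c := fun i ↦ ⟪b 1, y i⟫ / √(1 - ⟪e, y i⟫ ^ 2))
    (d := fun i ↦ ⟪b 2, y i⟫ / √(1 - ⟪e, y i⟫ ^ 2)) (fun i hi ↦ ?_) fun i hi j hj hij ↦ ?_)
  · rw [div_pow, div_pow, ← add_div, hunit i hi, Real.sq_sqrt (Real.sqrt_pos.1 (hr i hi)).le,
      div_self (Real.sqrt_pos.1 (hr i hi)).ne']
  · rw [div_mul_div_comm, div_mul_div_comm, ← add_div,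
      div_le_iff₀ (mul_pos (hr i hi) (hr j hj))]
    refine le_trans ?_ (half_sub_mul_le (h.lt_inner i hi).le (hlt i hi) (h.lt_inner j hj).le)
    linarith [hinner (y i) (y j), h.inner_le i hi j hj hij]

lemma IsCapCode.gThreeNeg_sum_le {ι : Type*} {e : EuclideanSpace ℝ (Fin 3)}
    {y : ι → EuclideanSpace ℝ (Fin 3)} {T : Finset ι} (h : IsCapCode e y T) :
    ∑ i ∈ T, gThreeNeg ⟪e, y i⟫ ≤ 2.89 := by
  have := h.card_le_four
  obtain hT | hT | hT : #T ≤ 2 ∨ #T = 3 ∨ #T = 4 := by omega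
  · linarith [h.gThreeNeg_sum_le_of_card_le_two hT]
  · linarith [h.gThreeNeg_sum_le_of_card_three hT]
  · exact h.gThreeNeg_sum_le_of_card_four hT

/-- Lemma 10: `ĝ₃ ∈ R(3, π/3)`. -/
theorem gThreeHat_nonneg_sum (N : ℕ)
    (x : Fin (N + 1) → EuclideanSpace ℝ (Fin 3))
    (hx : ∀ i, ‖x i‖ = 1)
    (hsep : ∀ i j : Fin (N + 1), i < j → ⟪x i, x j⟫ ≤ 1 / 2) :
    0 ≤ ∑ i, gThreeHat ⟪x 0, x i⟫ := by
  classical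
  have hsep' : ∀ i j, i ≠ j → ⟪x i, x j⟫ ≤ 1 / 2 := by
    intro i j hij
    rcases lt_or_gt_of_ne hij with h | h
    · exact hsep i j h
    · rw [real_inner_comm]
      exact hsep j i h
  set U : Finset (Fin (N + 1)) := univ.erase 0
  set T : Finset (Fin (N + 1)) := U.filter fun i ↦ 0 < gThreeNeg ⟪-x 0, x i⟫ with hTdef
  have hU : ∀ i ∈ U, ⟪x 0, x i⟫ ≤ 1 / 2 := fun i hi ↦ hsep' 0 i (ne_of_mem_erase hi).symm
  have hT : IsCapCode (-x 0) x T := by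
    refine ⟨by rw [norm_neg, hx], fun i _ ↦ hx i, fun i _ j _ ↦ hsep' i j, fun i hi ↦ ?_⟩
    obtain ⟨hiU, hpos⟩ := mem_filter.1 hi
    by_contra! hle
    refine hpos.not_ge (gThreeNeg_nonpos ?_ hle)
    rw [inner_neg_left]
    linarith [hU i hiU]
  have hterm : ∀ i ∈ U, gThreeHat ⟪x 0, x i⟫ =
      -(1 / 2.89) * if 0 < gThreeNeg ⟪-x 0, x i⟫ then gThreeNeg ⟪-x 0, x i⟫ else 0 := by
    intro i hi
    rw [gThreeHat, if_pos (hU i hi), inner_neg_left, ← gThree_neg, neg_neg]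
    split_ifs with h
    · exact min_eq_left (by nlinarith)
    · rw [mul_zero]
      exact min_eq_right (by nlinarith)
  have hzero : gThreeHat ⟪x 0, x 0⟫ = 1 := by
    rw [real_inner_self_eq_norm_sq, hx]
    norm_num [gThreeHat]
  rw [← add_sum_erase univ _ (mem_univ 0), hzero, sum_congr rfl hterm, ← mul_sum, ← sum_filter]
  linarith [hT.gThreeNeg_sum_le]
end

section
/- Any 13 distinct unit vectors x_1, …, x_13 in ℝ^3 contain a pair i ≠ j whose angular distance is at most 60.34 degrees; that is, there exist i ≠ j with ⟨x_i, x_j⟩ ≥ cos(60.34·π/180). Equivalently, there is no spherical (3, 13, α)-code with cos α < cos(60.34·π/180). -/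
open scoped RealInnerProductSpace BigOperators
open Real
open Finset

/-- Homogenized Chebyshev polynomials; they satisfy
`homChebyshev m (Re w) |w|² = Re (w ^ m)`. -/
def homChebyshev : ℕ → ℝ → ℝ → ℝ
  | 0, _, _ => 1
  | 1, r, _ => r
  | m + 2, r, s => 2 * r * homChebyshev (m + 1) r s - s * homChebyshev m r s

theorem homChebyshev_re_normSq (w : ℂ) (m : ℕ) :
    homChebyshev m w.re (Complex.normSq w) = (w ^ m).re := by
  induction m using Nat.twoStepInduction with
  | zero => simp [homChebyshev]
  | one => simp [homChebyshev]
  | more m ih₀ ih₁ =>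
    rw [homChebyshev, ih₀, ih₁, pow_succ w (m + 1), pow_succ w m, Complex.normSq_apply]
    simp only [Complex.mul_re, Complex.mul_im]
    ring

theorem sum_mul_homChebyshev_nonneg {ι : Type*} (s : Finset ι) (m : ℕ) (q : ι → ℝ) (ζ : ι → ℂ) :
    0 ≤ ∑ i ∈ s, ∑ j ∈ s, q i * q j *
      homChebyshev m ((ζ i).re * (ζ j).re + (ζ i).im * (ζ j).im)
        (Complex.normSq (ζ i) * Complex.normSq (ζ j)) := by
  have key : ∀ i j, q i * q j *
      homChebyshev m ((ζ i).re * (ζ j).re + (ζ i).im * (ζ j).im)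
        (Complex.normSq (ζ i) * Complex.normSq (ζ j)) =
      (q i * (ζ i ^ m).re) * (q j * (ζ j ^ m).re) +
        (q i * (ζ i ^ m).im) * (q j * (ζ j ^ m).im) := by
    intro i j
    have h := homChebyshev_re_normSq (ζ i * (starRingEnd ℂ) (ζ j)) m
    rw [mul_pow, ← map_pow, Complex.normSq_mul, Complex.normSq_conj] at h
    simp only [Complex.mul_re, Complex.conj_re, Complex.conj_im, mul_neg, sub_neg_eq_add] at h
    rw [h]
    ring
  simp only [key, sum_add_distrib, ← sum_mul_sum]
  exact add_nonneg (mul_self_nonneg _) (mul_self_nonneg _)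

/-- A function on `[-1, 1]` is positive definite on the sphere `S²` if the matrices
`(f ⟪x i, x j⟫)` have nonnegative entry sum for all finite families of unit vectors. -/
def IsPosDefZonal (f : ℝ → ℝ) : Prop :=
  ∀ (N : ℕ) (x : Fin N → EuclideanSpace ℝ (Fin 3)), (∀ i, ‖x i‖ = 1) →
    0 ≤ ∑ i, ∑ j, f ⟪x i, x j⟫

namespace IsPosDefZonal

theorem add {f g : ℝ → ℝ} (hf : IsPosDefZonal f) (hg : IsPosDefZonal g) :
    IsPosDefZonal fun t ↦ f t + g t := by
  intro N x hx
  simp only [sum_add_distrib]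
  exact add_nonneg (hf N x hx) (hg N x hx)

theorem const_mul {f : ℝ → ℝ} {c : ℝ} (hc : 0 ≤ c) (hf : IsPosDefZonal f) :
    IsPosDefZonal fun t ↦ c * f t := by
  intro N x hx
  simp only [← mul_sum]
  exact mul_nonneg hc (hf N x hx)

/-- A function satisfying an addition formula with nonnegative weights is positive definite. -/
theorem of_addition {f : ℝ → ℝ} {n : ℕ} {γ : Fin n → ℝ} {Q : Fin n → ℝ → ℝ}
    (hγ : ∀ m, 0 ≤ γ m)
    (h : ∀ a b r, f (a * b + r) =
      ∑ m, γ m * (Q m a * Q m b * homChebyshev m r ((1 - a ^ 2) * (1 - b ^ 2)))) :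
    IsPosDefZonal f := by
  intro N x hx
  have hsq : ∀ i, Complex.normSq ⟨x i 0, x i 1⟩ = 1 - x i 2 ^ 2 := by
    intro i
    have := EuclideanSpace.real_norm_sq_eq (x i)
    rw [hx i, Fin.sum_univ_three] at this
    rw [Complex.normSq_mk]
    linarith
  have hinner : ∀ i j, f ⟪x i, x j⟫ =
      ∑ m, γ m * (Q m (x i 2) * Q m (x j 2) *
        homChebyshev m (x i 0 * x j 0 + x i 1 * x j 1)
          (Complex.normSq ⟨x i 0, x i 1⟩ * Complex.normSq ⟨x j 0, x j 1⟩)) := by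
    intro i j
    rw [hsq, hsq, ← h, PiLp.inner_apply, Fin.sum_univ_three]
    simp only [RCLike.inner_apply, conj_trivial]
    ring_nf
  simp only [hinner]
  simp_rw [sum_comm (t := (univ : Finset (Fin n)))]
  refine sum_nonneg fun m _ ↦ ?_
  simp only [← mul_sum]
  exact mul_nonneg (hγ m) (sum_mul_homChebyshev_nonneg univ m (fun i ↦ Q m (x i 2))
    fun i ↦ ⟨x i 0, x i 1⟩)

end IsPosDefZonal

theorem isPosDefZonal_legendre_one :
    IsPosDefZonal fun t ↦ t :=
  .of_addition
    (γ := ![1, 1])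
    (Q := ![fun a ↦ a,
      fun _ ↦ 1])
    (fun m ↦ by fin_cases m <;> norm_num)
    (fun a b r ↦ by simp [Fin.sum_univ_succ, homChebyshev])

theorem isPosDefZonal_legendre_two :
    IsPosDefZonal fun t ↦ (3 * t ^ 2 - 1) / 2 :=
  .of_addition
    (γ := ![1 / 4, 3, 3 / 4])
    (Q := ![fun a ↦ 3 * a ^ 2 - 1,
      fun a ↦ a,
      fun _ ↦ 1])
    (fun m ↦ by fin_cases m <;> norm_num)
    (fun a b r ↦ by simp [Fin.sum_univ_succ, homChebyshev]; ring)

theorem isPosDefZonal_legendre_three :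
    IsPosDefZonal fun t ↦ (5 * t ^ 3 - 3 * t) / 2 :=
  .of_addition
    (γ := ![1 / 4, 3 / 8, 15 / 4, 5 / 8])
    (Q := ![fun a ↦ 5 * a ^ 3 - 3 * a,
      fun a ↦ 5 * a ^ 2 - 1,
      fun a ↦ a,
      fun _ ↦ 1])
    (fun m ↦ by fin_cases m <;> norm_num)
    (fun a b r ↦ by simp [Fin.sum_univ_succ, homChebyshev]; ring)

theorem isPosDefZonal_legendre_four :
    IsPosDefZonal fun t ↦ (35 * t ^ 4 - 30 * t ^ 2 + 3) / 8 :=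
  .of_addition
    (γ := ![1 / 64, 5 / 8, 5 / 16, 35 / 8, 35 / 64])
    (Q := ![fun a ↦ 35 * a ^ 4 - 30 * a ^ 2 + 3,
      fun a ↦ 7 * a ^ 3 - 3 * a,
      fun a ↦ 7 * a ^ 2 - 1,
      fun a ↦ a,
      fun _ ↦ 1])
    (fun m ↦ by fin_cases m <;> norm_num)
    (fun a b r ↦ by simp [Fin.sum_univ_succ, homChebyshev]; ring)

theorem isPosDefZonal_legendre_five :
    IsPosDefZonal fun t ↦ (63 * t ^ 5 - 70 * t ^ 3 + 15 * t) / 8 :=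
  .of_addition
    (γ := ![1 / 64, 15 / 64, 105 / 16, 35 / 128, 315 / 64, 63 / 128])
    (Q := ![fun a ↦ 63 * a ^ 5 - 70 * a ^ 3 + 15 * a,
      fun a ↦ 21 * a ^ 4 - 14 * a ^ 2 + 1,
      fun a ↦ 3 * a ^ 3 - a,
      fun a ↦ 9 * a ^ 2 - 1,
      fun a ↦ a,
      fun _ ↦ 1])
    (fun m ↦ by fin_cases m <;> norm_num)
    (fun a b r ↦ by simp [Fin.sum_univ_succ, homChebyshev]; ring)

theorem isPosDefZonal_legendre_eight :
    IsPosDefZonal fun t ↦ (6435 * t ^ 8 - 12012 * t ^ 6 + 6930 * t ^ 4 - 1260 * t ^ 2 + 35) / 128 :=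
  .of_addition
    (γ := ![1 / 16384, 9 / 1024, 315 / 2048, 1155 / 1024, 693 / 4096, 9009 / 1024, 429 / 2048,
      6435 / 1024, 6435 / 16384])
    (Q := ![fun a ↦ 6435 * a ^ 8 - 12012 * a ^ 6 + 6930 * a ^ 4 - 1260 * a ^ 2 + 35,
      fun a ↦ 715 * a ^ 7 - 1001 * a ^ 5 + 385 * a ^ 3 - 35 * a,
      fun a ↦ 143 * a ^ 6 - 143 * a ^ 4 + 33 * a ^ 2 - 1,
      fun a ↦ 39 * a ^ 5 - 26 * a ^ 3 + 3 * a,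
      fun a ↦ 65 * a ^ 4 - 26 * a ^ 2 + 1,
      fun a ↦ 5 * a ^ 3 - a,
      fun a ↦ 15 * a ^ 2 - 1,
      fun a ↦ a,
      fun _ ↦ 1])
    (fun m ↦ by fin_cases m <;> norm_num)
    (fun a b r ↦ by simp [Fin.sum_univ_succ, homChebyshev]; ring)

theorem isPosDefZonal_legendre_nine :
    IsPosDefZonal fun t ↦ (12155 * t ^ 9 - 25740 * t ^ 7 + 18018 * t ^ 5 - 4620 * t ^ 3 +
      315 * t) / 128 :=
  .of_addition
    (γ := ![1 / 16384, 45 / 16384, 495 / 2048, 1155 / 8192, 45045 / 4096, 1287 / 8192,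
      2145 / 2048, 6435 / 32768, 109395 / 16384, 12155 / 32768])
    (Q := ![fun a ↦ 12155 * a ^ 9 - 25740 * a ^ 7 + 18018 * a ^ 5 - 4620 * a ^ 3 + 315 * a,
      fun a ↦ 2431 * a ^ 8 - 4004 * a ^ 6 + 2002 * a ^ 4 - 308 * a ^ 2 + 7,
      fun a ↦ 221 * a ^ 7 - 273 * a ^ 5 + 91 * a ^ 3 - 7 * a,
      fun a ↦ 221 * a ^ 6 - 195 * a ^ 4 + 39 * a ^ 2 - 1,
      fun a ↦ 17 * a ^ 5 - 10 * a ^ 3 + a,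
      fun a ↦ 85 * a ^ 4 - 30 * a ^ 2 + 1,
      fun a ↦ 17 * a ^ 3 - 3 * a,
      fun a ↦ 17 * a ^ 2 - 1,
      fun a ↦ a,
      fun _ ↦ 1])
    (fun m ↦ by fin_cases m <;> norm_num)
    (fun a b r ↦ by simp [Fin.sum_univ_succ, homChebyshev]; ring)

/-- The auxiliary polynomial of degree `9` for the linear programming bound. -/
noncomputable def auxPoly (t : ℝ) : ℝ :=
  (t - 99 / 200) * (t + 153 / 200) * (t + 3 / 40) ^ 2 * (t + 2 / 5) ^ 2 *
    (t ^ 3 - 26 / 25 * t ^ 2 - 344181 / 340000 * t + 44985839 / 34000000)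

theorem isPosDefZonal_auxPoly_sub :
    IsPosDefZonal fun t ↦ auxPoly t - 2427159851784837 / 54400000000000000 := by
  have h := (((((((isPosDefZonal_legendre_one.const_mul
    (c := 5750544580328847 / 52360000000000000) (by norm_num)).add
    (isPosDefZonal_legendre_two.const_mul
      (c := 13067258096611181 / 83776000000000000) (by norm_num))).add
    (isPosDefZonal_legendre_three.const_mul
      (c := 3831002615291519 / 31824000000000000) (by norm_num))).add
    (isPosDefZonal_legendre_four.const_mul (c := 1647163751159 / 19337500000000) (by norm_num))).add
    (isPosDefZonal_legendre_five.const_mul (c := 3566143313 / 214200000000) (by norm_num))).add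
    (isPosDefZonal_legendre_eight.const_mul (c := 64 / 17875) (by norm_num))).add
    (isPosDefZonal_legendre_nine.const_mul (c := 128 / 12155) (by norm_num)))
  convert h using 2 with t
  rw [auxPoly]
  ring

theorem auxPoly_nonpos {t : ℝ} (h₁ : -(153 / 200) ≤ t) (h₂ : t ≤ 99 / 200) : auxPoly t ≤ 0 := by
  have hg : 0 ≤ t ^ 3 - 26 / 25 * t ^ 2 - 344181 / 340000 * t + 44985839 / 34000000 := by
    nlinarith [mul_nonneg (sq_nonneg (1 - t)) (by linarith : 0 ≤ 1 + t)]
  rw [auxPoly]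
  have h : 0 ≤ (99 / 200 - t) * (t + 153 / 200) :=
    mul_nonneg (by linarith) (by linarith)
  have := mul_nonneg (mul_nonneg (mul_nonneg h (sq_nonneg (t + 3 / 40)))
    (sq_nonneg (t + 2 / 5))) hg
  linarith

/-- A polynomial upper bound for `auxPoly (-u) / (u - 153 / 200)`. -/
noncomputable def auxQuot (u : ℝ) : ℝ :=
  (u + 99 / 200) * (u - 3 / 40) ^ 2 * (u - 2 / 5) ^ 2 *
    (-u ^ 3 - 26 / 25 * u ^ 2 + 2531 / 2500 * u + 827 / 625)

theorem auxPoly_neg_le {u : ℝ} (hu : 153 / 200 ≤ u) :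
    auxPoly (-u) ≤ (u - 153 / 200) * auxQuot u := by
  have h : 0 ≤ (u - 153 / 200) * (u + 99 / 200) * (u - 3 / 40) ^ 2 * (u - 2 / 5) ^ 2 := by
    have : 0 ≤ u - 153 / 200 := by linarith
    have : 0 ≤ u + 99 / 200 := by linarith
    positivity
  have := mul_le_mul_of_nonneg_left (show
    -u ^ 3 - 26 / 25 * u ^ 2 + 344181 / 340000 * u + 44985839 / 34000000 ≤
    -u ^ 3 - 26 / 25 * u ^ 2 + 2531 / 2500 * u + 827 / 625 by linarith) h
  rw [auxPoly, auxQuot]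
  linarith

theorem auxQuot_le {u : ℝ} (h₁ : 153 / 200 ≤ u) (h₂ : u ≤ 1) : auxQuot u ≤ 1661 / 10000 := by
  have hs (k l : ℕ) (h : u ≤ 189 / 200) : 0 ≤ (u - 153 / 200) ^ k * (189 / 200 - u) ^ l :=
    mul_nonneg (pow_nonneg (by linarith) k) (pow_nonneg (by linarith) l)
  have ht (k l : ℕ) (h : 189 / 200 ≤ u) : 0 ≤ (u - 189 / 200) ^ k * (1 - u) ^ l :=
    mul_nonneg (pow_nonneg (by linarith) k) (pow_nonneg (by linarith) l)
  rw [auxQuot]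
  rcases le_total u (189 / 200) with h | h
  · linarith [hs 0 8 h, hs 1 7 h, hs 2 6 h, hs 3 5 h, hs 4 4 h, hs 5 3 h,
      hs 6 2 h, hs 7 1 h, hs 8 0 h]
  · linarith [ht 0 8 h, ht 1 7 h, ht 2 6 h, ht 3 5 h, ht 4 4 h, ht 5 3 h,
      ht 6 2 h, ht 7 1 h, ht 8 0 h]

theorem mul_auxQuot_le {u : ℝ} (h₁ : 153 / 200 ≤ u) (h₂ : u ≤ 1) :
    (u - 153 / 200) * auxQuot u ≤ 331 / 10000 := by
  have hs (k l : ℕ) (h : u ≤ 197 / 200) : 0 ≤ (u - 153 / 200) ^ k * (197 / 200 - u) ^ l :=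
    mul_nonneg (pow_nonneg (by linarith) k) (pow_nonneg (by linarith) l)
  have ht (k l : ℕ) (h : 197 / 200 ≤ u) : 0 ≤ (u - 197 / 200) ^ k * (1 - u) ^ l :=
    mul_nonneg (pow_nonneg (by linarith) k) (pow_nonneg (by linarith) l)
  rw [auxQuot]
  rcases le_total u (197 / 200) with h | h
  · linarith [hs 0 9 h, hs 1 8 h, hs 2 7 h, hs 3 6 h, hs 4 5 h, hs 5 4 h,
      hs 6 3 h, hs 7 2 h, hs 8 1 h, hs 9 0 h]
  · linarith [ht 0 9 h, ht 1 8 h, ht 2 7 h, ht 3 6 h, ht 4 5 h, ht 5 4 h,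
      ht 6 3 h, ht 7 2 h, ht 8 1 h, ht 9 0 h]

theorem cos_angle_le : Real.cos (60.34 * π / 180) ≤ 99 / 200 := by
  have hδ : 60.34 * π / 180 = π / 3 + 17 * π / 9000 := by ring
  have hπ := Real.pi_gt_d2
  have hπ' := Real.pi_lt_d2
  have h3 : (1.73 : ℝ) ≤ √3 := Real.le_sqrt_of_sq_le (by norm_num)
  have hs : 17 * π / 9000 - (17 * π / 9000) ^ 3 / 6 < Real.sin (17 * π / 9000) :=
    Real.sin_gt_sub_cube (by positivity)
  have hs' : (0.00592 : ℝ) ≤ Real.sin (17 * π / 9000) := by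
    have : (17 * π / 9000) ^ 3 ≤ 0.006 ^ 3 := by
      gcongr
      linarith
    norm_num at this ⊢
    linarith
  rw [hδ, Real.cos_add, Real.cos_pi_div_three, Real.sin_pi_div_three]
  have := Real.cos_le_one (17 * π / 9000)
  have := mul_le_mul h3 hs' (by norm_num) (by positivity)
  norm_num at this
  linarith

/-- If unit vectors have pairwise inner products at most `c`, then the sum of their inner products
with a unit vector is bounded in terms of their number. -/
theorem sq_sum_inner_le {E ι : Type*} [NormedAddCommGroup E] [InnerProductSpace ℝ E]
    (S : Finset ι) (y : ι → E) (hy : ∀ i ∈ S, ‖y i‖ = 1) (c : ℝ)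
    (hc : ∀ i ∈ S, ∀ j ∈ S, i ≠ j → ⟪y i, y j⟫ ≤ c) (e : E) (he : ‖e‖ = 1) :
    (∑ i ∈ S, ⟪e, y i⟫) ^ 2 ≤ c * (#S : ℝ) ^ 2 + (1 - c) * #S := by
  classical
  have hrow : ∀ i ∈ S, ∑ j ∈ S, ⟪y i, y j⟫ ≤ c * #S + (1 - c) := by
    intro i hi
    have h1 : ⟪y i, y i⟫ = 1 := by rw [real_inner_self_eq_norm_sq, hy i hi, one_pow]
    have h2 : ∑ j ∈ S.erase i, ⟪y i, y j⟫ ≤ #(S.erase i) • c :=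
      sum_le_card_nsmul _ _ _ fun j hj ↦
        hc i hi j (mem_of_mem_erase hj) (ne_of_mem_erase hj).symm
    rw [card_erase_of_mem hi, nsmul_eq_mul, Nat.cast_pred (card_pos.2 ⟨i, hi⟩)] at h2
    rw [← add_sum_erase S _ hi, h1]
    linarith
  have hnorm : ‖∑ i ∈ S, y i‖ ^ 2 ≤ c * (#S : ℝ) ^ 2 + (1 - c) * #S := by
    rw [← real_inner_self_eq_norm_sq, sum_inner]
    simp only [inner_sum]
    calc ∑ i ∈ S, ∑ j ∈ S, ⟪y i, y j⟫ ≤ #S • (c * #S + (1 - c)) := sum_le_card_nsmul _ _ _ hrow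
      _ = _ := by rw [nsmul_eq_mul]; ring
  rw [← inner_sum]
  calc ⟪e, ∑ i ∈ S, y i⟫ ^ 2 ≤ (‖e‖ * ‖∑ i ∈ S, y i‖) ^ 2 :=
        sq_le_sq.2 ((abs_real_inner_le_norm _ _).trans (le_abs_self _))
    _ ≤ _ := by rwa [he, one_mul]

/-- The points in the cap opposite to a unit vector `e` contribute at most `331 / 10000`. -/
theorem sum_auxPoly_cap_le {E ι : Type*} [NormedAddCommGroup E] [InnerProductSpace ℝ E]
    (S : Finset ι) (y : ι → E) (hy : ∀ i ∈ S, ‖y i‖ = 1)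
    (hc : ∀ i ∈ S, ∀ j ∈ S, i ≠ j → ⟪y i, y j⟫ ≤ 99 / 200) (e : E) (he : ‖e‖ = 1)
    (hcap : ∀ i ∈ S, ⟪e, y i⟫ ≤ -(153 / 200)) :
    ∑ i ∈ S, auxPoly ⟪e, y i⟫ ≤ 331 / 10000 := by
  have hlow : ∀ i ∈ S, -⟪e, y i⟫ ≤ 1 := fun i hi ↦ by
    have := neg_le_of_abs_le (abs_real_inner_le_norm e (y i))
    rw [he, hy i hi] at this
    linarith
  have hF : ∀ i ∈ S, auxPoly ⟪e, y i⟫ ≤ (-⟪e, y i⟫ - 153 / 200) * auxQuot (-⟪e, y i⟫) :=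
    fun i hi ↦ by
      have := auxPoly_neg_le (u := -⟪e, y i⟫) (by linarith [hcap i hi])
      rwa [neg_neg] at this
  rcases Nat.lt_or_ge #S 2 with hS | hS
  · interval_cases h : #S
    · rw [card_eq_zero.1 h]
      norm_num
    · obtain ⟨i, rfl⟩ := card_eq_one.1 h
      have hi := mem_singleton_self i
      rw [sum_singleton]
      exact (hF i hi).trans (mul_auxQuot_le (by linarith [hcap i hi]) (hlow i hi))
  · have hlin : ∀ i ∈ S, auxPoly ⟪e, y i⟫ ≤ 1661 / 10000 * (-⟪e, y i⟫ - 153 / 200) := fun i hi ↦ by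
      have hu := hcap i hi
      refine (hF i hi).trans ?_
      rw [mul_comm]
      exact mul_le_mul_of_nonneg_right (auxQuot_le (by linarith) (hlow i hi)) (by linarith)
    have hsq := sq_sum_inner_le S y hy _ hc e he
    have hm : (2 : ℝ) ≤ #S := by exact_mod_cast hS
    have hU : -∑ i ∈ S, ⟪e, y i⟫ ≤ 153 / 200 * #S + 249 / 1250 :=
      abs_le_of_sq_le_sq' (a := ∑ i ∈ S, ⟪e, y i⟫) (by nlinarith) (by positivity) |>.1 |> neg_le.1
    calc ∑ i ∈ S, auxPoly ⟪e, y i⟫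
        ≤ ∑ i ∈ S, 1661 / 10000 * (-⟪e, y i⟫ - 153 / 200) := sum_le_sum hlin
      _ = 1661 / 10000 * (-∑ i ∈ S, ⟪e, y i⟫ - 153 / 200 * #S) := by
        rw [← mul_sum, sum_sub_distrib, sum_neg_distrib, sum_const, nsmul_eq_mul]; ring
      _ ≤ 331 / 10000 := by linarith

/-- Any 13 distinct unit vectors in ℝ^3 contain a pair at angular distance
at most 60.34 degrees. -/
theorem sphere_code_dim3_N13 (x : Fin 13 → EuclideanSpace ℝ (Fin 3))
    (hx : ∀ i, ‖x i‖ = 1) (hinj : Function.Injective x) :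
    ∃ i j, i ≠ j ∧ ⟪x i, x j⟫ ≥ Real.cos (60.34 * π / 180) := by
  by_contra! hcon
  have hsep : ∀ i j, i ≠ j → ⟪x i, x j⟫ ≤ 99 / 200 := fun i j hij ↦
    (hcon i j hij).le.trans cos_angle_le
  have hrow : ∀ i, ∑ j, auxPoly ⟪x i, x j⟫ ≤ auxPoly 1 + 331 / 10000 := by
    intro i
    rw [← add_sum_erase univ _ (mem_univ i), real_inner_self_eq_norm_sq, hx i, one_pow]
    gcongr
    rw [← sum_filter_add_sum_filter_not (univ.erase i) fun j ↦ ⟪x i, x j⟫ ≤ -(153 / 200)]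
    have hcap := sum_auxPoly_cap_le ((univ.erase i).filter fun j ↦ ⟪x i, x j⟫ ≤ -(153 / 200)) x
      (fun j _ ↦ hx j) (fun j _ k _ ↦ hsep j k) (x i) (hx i) fun j hj ↦ (mem_filter.1 hj).2
    have hrest := sum_nonpos fun j
      (hj : j ∈ (univ.erase i).filter fun j ↦ ¬ ⟪x i, x j⟫ ≤ -(153 / 200)) ↦
      have hj' := mem_filter.1 hj
      auxPoly_nonpos (not_le.1 hj'.2).le (hsep i j (ne_of_mem_erase hj'.1).symm)
    linarith
  have hupper := sum_le_sum fun i (_ : i ∈ univ) ↦ hrow i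
  have hlower := isPosDefZonal_auxPoly_sub 13 x hx
  simp only [sum_sub_distrib, sum_const, card_univ, Fintype.card_fin, nsmul_eq_mul] at hlower hupper
  rw [auxPoly] at hupper
  norm_num at hlower hupper
  linarith
end

section
/- Any 24 distinct unit vectors x_1, …, x_24 in ℝ^3 contain a pair i ≠ j whose angular distance is at most 44.43 degrees; that is, there exist i ≠ j with ⟨x_i, x_j⟩ ≥ cos(44.43·π/180). Equivalently, there is no spherical (3, 24, α)-code with cos α < cos(44.43·π/180). -/
open scoped RealInnerProductSpace BigOperators
open Real

section Zonal

open Finset Polynomial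

/-- The Legendre polynomial of degree `k`, in Murphy's form. -/
noncomputable def legendreMurphy (k : ℕ) (t : ℝ) : ℝ :=
  ∑ j ∈ range (k + 1), (k.choose j : ℝ) ^ 2 * ((1 + t) / 2) ^ j * ((t - 1) / 2) ^ (k - j)

theorem coeff_linear_pow {R : Type*} [CommRing R] (a b : R) {n i : ℕ} (hi : i ≤ n) :
    ((C a * X + C b) ^ n).coeff i = n.choose i * a ^ i * b ^ (n - i) := by
  have h (m : ℕ) : (C a * X) ^ m * C b ^ (n - m) * (n.choose m : R[X]) =
      C (n.choose m * a ^ m * b ^ (n - m)) * X ^ m := by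
    simp only [map_mul, map_pow, map_natCast]
    ring
  simp only [add_pow, h, finsetSum_coeff, coeff_C_mul_X_pow]
  rw [sum_ite_eq, if_pos (mem_range.2 (Nat.lt_succ_of_le hi))]

/-- The sum over all `k`-subsets `T` of a `2k`-set of the products of the entries
`M (i ∈ S) (i ∈ T)`. -/
theorem sum_powersetCard_prod {R : Type*} [CommRing R] {ι : Type*} [Fintype ι] [DecidableEq ι]
    {k : ℕ} (hι : Fintype.card ι = 2 * k) (M : Bool → Bool → R) {S : Finset ι} (hS : #S = k) :
    ∑ T ∈ powersetCard k (univ : Finset ι), ∏ i, M (decide (i ∈ S)) (decide (i ∈ T)) =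
      ∑ j ∈ range (k + 1), (k.choose j : R) ^ 2 * (M true true * M false false) ^ j *
        (M true false * M false true) ^ (k - j) := by
  have hSc : #Sᶜ = k := by rw [card_compl, hι, hS]; omega
  have h1 : ∏ i : ι, (C (M (decide (i ∈ S)) true) * X + C (M (decide (i ∈ S)) false)) =
      (C (M true true) * X + C (M true false)) ^ k *
        (C (M false true) * X + C (M false false)) ^ k := by
    rw [← prod_mul_prod_compl S]
    congr 1
    · rw [← hS, ← prod_const]
      exact prod_congr rfl fun i hi => by simp [hi]
    · rw [← hSc, ← prod_const]
      exact prod_congr rfl fun i hi => by simp [mem_compl.1 hi]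
  have h2 : ∏ i : ι, (C (M (decide (i ∈ S)) true) * X + C (M (decide (i ∈ S)) false)) =
      ∑ T : Finset ι, C (∏ i, M (decide (i ∈ S)) (decide (i ∈ T))) * X ^ #T := by
    rw [Fintype.prod_add]
    refine sum_congr rfl fun T _ => ?_
    rw [prod_mul_distrib, prod_const, ← prod_mul_prod_compl T, map_mul, map_prod, map_prod]
    rw [mul_right_comm]
    congr 2
    · exact prod_congr rfl fun i hi => by simp [hi]
    · exact prod_congr rfl fun i hi => by simp [mem_compl.1 hi]
  have h3 := congrArg (coeff · k) (h2.symm.trans h1)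
  simp only [finsetSum_coeff, coeff_C_mul, coeff_X_pow, mul_ite, mul_one, mul_zero] at h3
  rw [← sum_filter] at h3
  have h4 : (univ.filter fun T : Finset ι => k = #T) = powersetCard k univ := by
    ext T; simp [mem_powersetCard, eq_comm]
  rw [h4] at h3
  rw [h3, coeff_mul, Nat.sum_antidiagonal_eq_sum_range_succ_mk]
  refine sum_congr rfl fun j hj => ?_
  have hj' : j ≤ k := Nat.lt_succ_iff.1 (mem_range.1 hj)
  rw [coeff_linear_pow _ _ hj', coeff_linear_pow _ _ (Nat.sub_le _ _),
    Nat.choose_symm hj', Nat.sub_sub_self hj']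
  ring

/-- The Gram matrix of a family of pure tensors. -/
theorem sum_sum_prod_eq_sum_normSq {κ ι β : Type*} [Fintype ι] [DecidableEq ι] [Fintype β]
    (P : Finset κ) (A : κ → ι → β → ℂ) :
    ∑ p ∈ P, ∑ q ∈ P, ∏ i, ∑ b, A p i b * (starRingEnd ℂ) (A q i b) =
      ((∑ v : ι → β, Complex.normSq (∑ p ∈ P, ∏ i, A p i (v i)) : ℝ) : ℂ) := by
  simp only [Fintype.prod_sum, prod_mul_distrib]
  push_cast
  simp only [← Complex.mul_conj, map_sum, map_prod, sum_mul_sum]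
  exact (sum_congr rfl fun p _ => sum_comm).trans sum_comm

/-- Homogeneous coordinates on the Riemann sphere. -/
theorem exists_spinor {x y z : ℝ} (h : x ^ 2 + y ^ 2 + z ^ 2 = 1) :
    ∃ a b : ℂ, a * (starRingEnd ℂ) a = (1 + z) / 2 ∧ b * (starRingEnd ℂ) b = (1 - z) / 2 ∧
      a * (starRingEnd ℂ) b = (x + y * Complex.I) / 2 := by
  rcases eq_or_ne z (-1) with rfl | hz
  · have hx : x = 0 := by nlinarith
    have hy : y = 0 := by nlinarith
    exact ⟨0, 1, by simp, by norm_num, by simp [hx, hy]⟩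
  · have hz' : 0 < (1 + z) / 2 := by
      have : -1 < z := lt_of_le_of_ne (by nlinarith) hz.symm
      linarith
    set r := √((1 + z) / 2) with hr
    have hr2 : (r : ℂ) * r = (1 + z) / 2 := by
      have := Real.mul_self_sqrt hz'.le
      rw [← hr] at this
      exact_mod_cast this
    have hr0 : (r : ℂ) ≠ 0 := by exact_mod_cast (Real.sqrt_pos.2 hz').ne'
    have h' : (x : ℂ) ^ 2 + y ^ 2 + z ^ 2 = 1 := by exact_mod_cast h
    refine ⟨r, (x - y * Complex.I) / (2 * r), ?_, ?_, ?_⟩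
    · simpa using hr2
    · simp only [map_div₀, map_sub, map_mul, Complex.conj_ofReal, Complex.conj_I, map_ofNat]
      rw [div_mul_div_comm, div_eq_div_iff (by simpa using hr0) two_ne_zero]
      linear_combination 2 * h' - 4 * (1 - z : ℂ) * hr2 - 2 * (y : ℂ) ^ 2 * Complex.I_mul_I
    · simp only [map_div₀, map_sub, map_mul, Complex.conj_ofReal, Complex.conj_I, map_ofNat]
      field_simp
      ring

/-- The matrix in `SU(2)` with first row `(a, b)`. -/
def spinorMatrix (a b : ℂ) : Bool → Bool → ℂ
  | true, true => a
  | true, false => b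
  | false, true => -(starRingEnd ℂ) b
  | false, false => (starRingEnd ℂ) a

theorem sum_legendreMurphy_inner_nonneg (k : ℕ) {α : Type*} [Fintype α]
    {x : α → EuclideanSpace ℝ (Fin 3)} (hx : ∀ i, ‖x i‖ = 1) :
    0 ≤ ∑ i, ∑ j, legendreMurphy k ⟪x i, x j⟫ := by
  have hx' (i) : x i 0 ^ 2 + x i 1 ^ 2 + x i 2 ^ 2 = 1 := by
    have := EuclideanSpace.real_norm_sq_eq (x i)
    rw [hx, Fin.sum_univ_three] at this
    linarith
  choose a b haa hbb hab using fun i => exists_spinor (hx' i)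
  have hba (i) : b i * (starRingEnd ℂ) (a i) = (x i 0 - x i 1 * Complex.I) / 2 := by
    have := congrArg (starRingEnd ℂ) (hab i)
    simp only [map_div₀, map_add, map_mul, Complex.conj_ofReal, Complex.conj_I, map_ofNat,
      Complex.conj_conj] at this
    rw [mul_comm, this]
    ring
  have hI : Complex.I * Complex.I = -1 := Complex.I_mul_I
  have key (i j) {S : Finset (Fin (2 * k))} (hS : #S = k) :
      ∑ T ∈ powersetCard k univ, ∏ l, ∑ c, spinorMatrix (a i) (b i) (decide (l ∈ S)) c *
        (starRingEnd ℂ) (spinorMatrix (a j) (b j) (decide (l ∈ T)) c) =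
      (legendreMurphy k ⟪x i, x j⟫ : ℝ) := by
    rw [sum_powersetCard_prod (Fintype.card_fin _) (fun s t => ∑ c, spinorMatrix (a i) (b i) s c *
        (starRingEnd ℂ) (spinorMatrix (a j) (b j) t c)) hS, legendreMurphy]
    have hin : ((⟪x i, x j⟫ : ℝ) : ℂ) = x i 0 * x j 0 + x i 1 * x j 1 + x i 2 * x j 2 := by
      rw [PiLp.inner_apply, Fin.sum_univ_three]
      simp [mul_comm]
    push_cast
    rw [hin]
    simp only [Fintype.sum_bool, spinorMatrix, map_neg, Complex.conj_conj]
    refine sum_congr rfl fun m _ => ?_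
    congr 2
    · congr 1
      linear_combination (a j * (starRingEnd ℂ) (a j)) * haa i + (1 + x i 2 : ℂ) / 2 * haa j +
        (b j * (starRingEnd ℂ) (b j)) * hbb i + (1 - x i 2 : ℂ) / 2 * hbb j +
        (b j * (starRingEnd ℂ) (a j)) * hab i + (x i 0 + x i 1 * Complex.I) / 2 * hba j +
        (a j * (starRingEnd ℂ) (b j)) * hba i + (x i 0 - x i 1 * Complex.I) / 2 * hab j
        - (x i 1 * x j 1 / 2 : ℂ) * hI
    · linear_combination -(a j * (starRingEnd ℂ) (a j)) * hbb i - (1 - x i 2 : ℂ) / 2 * haa j -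
        (b j * (starRingEnd ℂ) (b j)) * haa i - (1 + x i 2 : ℂ) / 2 * hbb j +
        (b j * (starRingEnd ℂ) (a j)) * hab i + (x i 0 + x i 1 * Complex.I) / 2 * hba j +
        (a j * (starRingEnd ℂ) (b j)) * hba i + (x i 0 - x i 1 * Complex.I) / 2 * hab j
        - (x i 1 * x j 1 / 2 : ℂ) * hI
  have h := sum_sum_prod_eq_sum_normSq
    ((univ : Finset α) ×ˢ powersetCard k (univ : Finset (Fin (2 * k))))
    (fun p l c => spinorMatrix (a p.1) (b p.1) (decide (l ∈ p.2)) c)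
  simp only [sum_product] at h
  have h' : ∑ i, ∑ S ∈ powersetCard k (univ : Finset (Fin (2 * k))), ∑ j,
      ∑ T ∈ powersetCard k univ, ∏ l, ∑ c, spinorMatrix (a i) (b i) (decide (l ∈ S)) c *
        (starRingEnd ℂ) (spinorMatrix (a j) (b j) (decide (l ∈ T)) c) =
      (((2 * k).choose k * ∑ i, ∑ j, legendreMurphy k ⟪x i, x j⟫ : ℝ) : ℂ) := by
    push_cast
    rw [mul_sum]
    refine sum_congr rfl fun i _ => ?_
    rw [sum_congr rfl fun S hS => sum_congr rfl fun j _ => key i j (mem_powersetCard.1 hS).2]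
    simp
  rw [h', Complex.ofReal_inj] at h
  have hpos : (0 : ℝ) < (2 * k).choose k := by exact_mod_cast Nat.choose_pos (by omega)
  refine nonneg_of_mul_nonneg_right ?_ hpos
  rw [h]
  exact sum_nonneg fun v _ => Complex.normSq_nonneg _

end Zonal

/-- Value at `x` of the polynomial with coefficient list `L`, constant term first. -/
noncomputable def listEval (L : List ℚ) (x : ℝ) : ℝ := L.foldr (fun (c : ℚ) (v : ℝ) => c + x * v) 0

/-- Coefficient list of `c + (m + X) * L`. -/
def consShift (m : ℚ) : ℚ → List ℚ → List ℚ
  | c, [] => [c]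
  | c, q :: L => (c + m * q) :: consShift m q L

/-- Coefficient list of the polynomial `L` expanded around `m`. -/
def taylorShift (m : ℚ) (L : List ℚ) : List ℚ := L.foldr (consShift m) []

/-- Lower bound on `[0, h]`, by interval Horner evaluation, for the polynomial `L`. -/
def hornerLower (h : ℚ) (L : List ℚ) : ℚ := L.foldr (fun c v => c + min 0 (h * v)) 0

/-- Test whether `hornerLower` shows that `L` is nonnegative between all successive points
of the list `a :: bs`. -/
def nonnegTest (L : List ℚ) : ℚ → List ℚ → Bool
  | _, [] => true
  | a, b :: bs => decide (0 ≤ hornerLower (b - a) (taylorShift a L)) && nonnegTest L b bs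

theorem listEval_consShift (m : ℚ) (L : List ℚ) (c : ℚ) (x : ℝ) :
    listEval (consShift m c L) x = c + (m + x) * listEval L x := by
  induction L generalizing c with
  | nil => simp [consShift, listEval]
  | cons q L ih =>
    have h := ih q
    simp only [listEval, consShift, List.foldr_cons] at h ⊢
    rw [h]
    push_cast
    ring

theorem listEval_taylorShift (m : ℚ) (L : List ℚ) (x : ℝ) :
    listEval (taylorShift m L) x = listEval L (m + x) := by
  induction L with
  | nil => simp [taylorShift, listEval]
  | cons c L ih =>
    have h := listEval_consShift m (taylorShift m L) c x
    rw [ih] at h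
    simpa [taylorShift, listEval] using h

theorem hornerLower_le_listEval {h : ℚ} {x : ℝ} (hx : 0 ≤ x) (hxh : x ≤ h) (L : List ℚ) :
    (hornerLower h L : ℝ) ≤ listEval L x := by
  induction L with
  | nil => simp [hornerLower, listEval]
  | cons c L ih =>
    simp only [hornerLower, listEval, List.foldr_cons] at ih ⊢
    set v := L.foldr (fun c v => c + min 0 (h * v)) 0
    set w := L.foldr (fun (c : ℚ) (v : ℝ) => c + x * v) 0
    push_cast
    refine add_le_add le_rfl ?_
    rcases le_total 0 (v : ℝ) with hv | hv
    · exact (min_le_left _ _).trans (mul_nonneg hx (hv.trans ih))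
    · refine (min_le_right _ _).trans ?_
      nlinarith [mul_le_mul_of_nonneg_left ih hx, mul_le_mul_of_nonpos_right hxh hv]

theorem listEval_nonneg_of_nonnegTest {L : List ℚ} {a : ℚ} {bs : List ℚ}
    (h : nonnegTest L a bs = true) {x : ℝ} (hbs : bs ≠ []) (hax : a ≤ x)
    (hxb : x ≤ (bs.getLast hbs : ℚ)) : 0 ≤ listEval L x := by
  induction bs generalizing a with
  | nil => exact absurd rfl hbs
  | cons b bs ih =>
    simp only [nonnegTest, Bool.and_eq_true, decide_eq_true_eq] at h
    by_cases hb : x ≤ b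
    · have h1 := hornerLower_le_listEval (h := b - a) (sub_nonneg.2 hax)
        (by push_cast; linarith) (taylorShift a L)
      rw [listEval_taylorShift] at h1
      have h2 : (0 : ℝ) ≤ (hornerLower (b - a) (taylorShift a L) : ℚ) := by exact_mod_cast h.1
      simpa using h2.trans h1
    · push Not at hb
      rcases bs with _ | ⟨b', bs⟩
      · simp at hxb; linarith
      · exact ih h.2 (by simp) hb.le (by simpa using hxb)

theorem cos_bound_44_43 : Real.cos (44.43 * π / 180) ≤ 714107 / 1000000 := by
  set e : ℝ := 0.57 * π / 180 with he
  have h1 : 44.43 * π / 180 = π / 4 - e := by rw [he]; ring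
  have hπ := Real.pi_lt_d6
  have hπ' := Real.pi_gt_d6
  have he0 : 0.0099483 < e := by rw [he]; linarith
  have he1 : e < 0.0099484 := by rw [he]; linarith
  have hs : Real.sin e ≤ e := Real.sin_le (by linarith)
  have hc := (abs_le.1 (Real.cos_bound (x := e) (by rw [abs_of_pos] <;> linarith))).2
  rw [abs_of_pos (by linarith)] at hc
  have h4 : e ^ 4 ≤ 0.0099484 ^ 4 := pow_le_pow_left₀ (by linarith) he1.le 4
  have h2 : (0.0099483 : ℝ) ^ 2 ≤ e ^ 2 := pow_le_pow_left₀ (by norm_num) he0.le 2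
  have hsum : Real.cos e + Real.sin e ≤ 1.0098990 := by norm_num at h4 h2 ⊢; linarith
  have hq : √2 ≤ 1.4142136 := by
    rw [Real.sqrt_le_left (by norm_num)]; norm_num
  rw [h1, Real.cos_sub, Real.cos_pi_div_four, Real.sin_pi_div_four]
  have : √2 / 2 * cos e + √2 / 2 * sin e = √2 * (cos e + sin e) / 2 := by ring
  rw [this]
  nlinarith [mul_le_mul_of_nonneg_left hsum (Real.sqrt_nonneg 2)]

/-- Unit vectors with pairwise inner products at most `s` cannot concentrate around a unit vector:
a linear bound for their inner products with `u`. -/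
theorem sum_inner_sub_le {E ι : Type*} [NormedAddCommGroup E] [InnerProductSpace ℝ E]
    {s κ B : ℝ} (hκ : 0 ≤ κ) (hB : 0 ≤ B)
    (hs : ∀ m : ℝ, m + m * (m - 1) * s ≤ (κ * m + B) ^ 2) {u : E} (hu : ‖u‖ = 1) {y : ι → E}
    (hy : ∀ j, ‖y j‖ = 1) (hys : ∀ i j, i ≠ j → ⟪y i, y j⟫ ≤ s) (J : Finset ι) :
    ∑ j ∈ J, (⟪u, y j⟫ - κ) ≤ B := by
  classical
  have hnorm : ‖∑ j ∈ J, y j‖ ^ 2 ≤ (κ * J.card + B) ^ 2 := by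
    refine le_trans ?_ (hs J.card)
    rw [← real_inner_self_eq_norm_sq, sum_inner]
    have hrow (i) (hi : i ∈ J) : ⟪y i, ∑ j ∈ J, y j⟫ ≤ 1 + (J.card - 1) * s := by
      rw [inner_sum, ← Finset.add_sum_erase J _ hi, real_inner_self_eq_norm_sq, hy]
      have h := Finset.sum_le_card_nsmul (J.erase i) (fun j => ⟪y i, y j⟫) s
        fun j hj => hys i j (Finset.ne_of_mem_erase hj).symm
      rw [nsmul_eq_mul, Finset.cast_card_erase_of_mem hi] at h
      linarith
    refine (Finset.sum_le_card_nsmul J _ _ hrow).trans_eq ?_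
    rw [nsmul_eq_mul]
    ring
  have h1 := abs_le_of_sq_le_sq' hnorm (by positivity)
  have h2 := real_inner_le_norm u (∑ j ∈ J, y j)
  rw [hu, one_mul, inner_sum] at h2
  rw [Finset.sum_sub_distrib, Finset.sum_const, nsmul_eq_mul]
  linarith [h1.2]

/-- A combination of Legendre polynomials with constant term one and nonnegative coefficients. -/
noncomputable def codePoly (t : ℝ) : ℝ :=
  1 + 283489 / 100000 * legendreMurphy 1 t + 84679 / 20000 * legendreMurphy 2 t +
    59663 / 12500 * legendreMurphy 3 t + 444449 / 100000 * legendreMurphy 4 t +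
    10306 / 3125 * legendreMurphy 5 t + 37277 / 20000 * legendreMurphy 6 t +
    35279 / 50000 * legendreMurphy 7 t + 629 / 2500 * legendreMurphy 11 t +
    13997 / 100000 * legendreMurphy 12 t + 1417 / 10000 * legendreMurphy 13 t

theorem codePoly_eq (t : ℝ) : 102400000 * codePoly t =
    -119717 + 5113502 * t - 56040186 * t ^ 2 - 76054500 * t ^ 3 + 1386084245 * t ^ 4
      + 1314286722 * t ^ 5 - 11535701100 * t ^ 6 - 15313621752 * t ^ 7 + 29092834485 * t ^ 8
      + 45479998850 * t ^ 9 - 27153312186 * t ^ 10 - 48602501220 * t ^ 11 + 9462517883 * t ^ 12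
      + 18422062750 * t ^ 13 := by
  simp only [codePoly, legendreMurphy, Finset.sum_range_succ, Finset.sum_range_zero]
  norm_num [Nat.choose]
  ring

theorem codePoly_one : codePoly 1 = 2368699 / 100000 := by
  linarith [codePoly_eq 1]

theorem codePoly_nonpos {t : ℝ} (h1 : -847 / 1000 ≤ t) (h2 : t ≤ 714107 / 1000000) :
    codePoly t ≤ 0 := by
  have h := listEval_nonneg_of_nonnegTest (L := [119717, -5113502, 56040186, 76054500, -1386084245,
      -1314286722, 11535701100, 15313621752, -29092834485, -45479998850, 27153312186, 48602501220,
      -9462517883, -18422062750]) (a := -847/1000)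
    (bs := [-763/1000, -7/10, -133/200, -323/500, -317/500, -313/500, -619/1000, -521/1000,
      -459/1000, -109/250, -17/40, -2/5, -177/1000, -9/200, 3/1000, 3/125, 9/250, 11/250, 63/1000,
      189/1000, 29/125, 61/250, 1/4, 33/125, 83/125, 357/500, 714107/1000000])
    (by decide +kernel) (by simp) (x := t) (by push_cast; linarith)
    (by push_cast [List.getLast]; linarith)
  simp only [listEval, List.foldr_cons, List.foldr_nil] at h
  push_cast at h
  linarith [codePoly_eq t]

theorem codePoly_le_linear {t : ℝ} (h1 : -1 ≤ t) (h2 : t ≤ -847 / 1000) :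
    codePoly t ≤ 99 / 50 * (-t - 847 / 1000) := by
  have h := listEval_nonneg_of_nonnegTest (L := [-171611227, -207865502, 56040186, 76054500,
      -1386084245, -1314286722, 11535701100, 15313621752, -29092834485, -45479998850, 27153312186,
      48602501220, -9462517883, -18422062750]) (a := -1)
    (bs := [-39/40, -239/250, -471/500, -933/1000, -927/1000, -923/1000, -23/25, -183/200,
      -109/125, -106/125, -847/1000])
    (by decide +kernel) (by simp) (x := t) (by push_cast; linarith)
    (by push_cast [List.getLast]; linarith)
  simp only [listEval, List.foldr_cons, List.foldr_nil] at h
  push_cast at h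
  linarith [codePoly_eq t]

theorem card_sq_le_sum_codePoly {α : Type*} [Fintype α] {x : α → EuclideanSpace ℝ (Fin 3)}
    (hx : ∀ i, ‖x i‖ = 1) : (Fintype.card α : ℝ) ^ 2 ≤ ∑ i, ∑ j, codePoly ⟪x i, x j⟫ := by
  have h (k : ℕ) := sum_legendreMurphy_inner_nonneg k hx
  simp only [codePoly, Finset.sum_add_distrib, ← Finset.mul_sum, Finset.sum_const,
    Finset.card_univ, nsmul_eq_mul, mul_one]
  linarith [h 1, h 2, h 3, h 4, h 5, h 6, h 7, h 11, h 12, h 13]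

theorem sum_codePoly_le {α : Type*} [Fintype α] [DecidableEq α]
    {x : α → EuclideanSpace ℝ (Fin 3)} (hx : ∀ i, ‖x i‖ = 1)
    (hs : ∀ i j, i ≠ j → ⟪x i, x j⟫ ≤ 714107 / 1000000) (i : α) :
    ∑ j, codePoly ⟪x i, x j⟫ ≤ 2368699 / 100000 + 99 / 50 * (3161 / 20000) := by
  have hterm (j) : codePoly ⟪x i, x j⟫ ≤ (if j = i then 2368699 / 100000 else 0) +
      if ⟪x i, x j⟫ ≤ -847 / 1000 then 99 / 50 * (⟪-x i, x j⟫ - 847 / 1000) else 0 := by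
    by_cases hji : j = i
    · subst hji
      rw [real_inner_self_eq_norm_sq, hx, one_pow, codePoly_one]
      norm_num
    · rw [if_neg hji, zero_add, inner_neg_left]
      split_ifs with hcap
      · refine codePoly_le_linear ?_ hcap
        have := abs_real_inner_le_norm (x i) (x j)
        rw [hx, hx, one_mul] at this
        exact (abs_le.1 this).1
      · exact codePoly_nonpos (not_le.1 hcap).le (hs i j (Ne.symm hji))
  refine (Finset.sum_le_sum fun j _ => hterm j).trans ?_
  rw [Finset.sum_add_distrib, Finset.sum_ite_eq', if_pos (Finset.mem_univ i),
    ← Finset.sum_filter, ← Finset.mul_sum]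
  gcongr
  refine sum_inner_sub_le (s := 714107 / 1000000) (by norm_num) (by norm_num) (fun m => ?_)
    (by rw [norm_neg, hx]) hx hs _
  nlinarith [sq_nonneg (m - 2734 / 1000)]

/-- Any 24 distinct unit vectors in ℝ^3 contain a pair at angular distance
at most 44.43 degrees. -/
theorem sphere_code_dim3_N24 (x : Fin 24 → EuclideanSpace ℝ (Fin 3))
    (hx : ∀ i, ‖x i‖ = 1) (hinj : Function.Injective x) :
    ∃ i j, i ≠ j ∧ ⟪x i, x j⟫ ≥ Real.cos (44.43 * π / 180) := by
  by_contra! h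
  have hs (i j) (hij : i ≠ j) : ⟪x i, x j⟫ ≤ 714107 / 1000000 :=
    (h i j hij).le.trans cos_bound_44_43
  have h1 := card_sq_le_sum_codePoly hx
  have h2 := Finset.sum_le_sum fun i (_ : i ∈ Finset.univ) => sum_codePoly_le hx hs i
  simp only [Finset.sum_const, Finset.card_univ, Fintype.card_fin, nsmul_eq_mul] at h1 h2
  norm_num at h1 h2
  linarith
end

section
/- Any 24 distinct unit vectors x_1, …, x_24 in ℝ^4 contain a pair i ≠ j whose angular distance is at most 60.38 degrees; that is, there exist i ≠ j with ⟨x_i, x_j⟩ ≥ cos(60.38·π/180). Equivalently, there is no spherical (4, 24, α)-code with cos α < cos(60.38·π/180). -/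
open scoped RealInnerProductSpace BigOperators
open Real

namespace SphereCode

section CoefficientLists

variable {α : Type}

/-- Coefficientwise sum of two coefficient lists. -/
def addList (f : α → α → α) : List α → List α → List α
  | [], b => b
  | a :: as, [] => a :: as
  | a :: as, b :: bs => f a b :: addList f as bs

/-- Product of two coefficient lists, given zero, addition and multiplication of coefficients. -/
def mulList (z : α) (add mul : α → α → α) : List α → List α → List α
  | [], _ => []
  | a :: as, b => addList add (b.map (mul a)) (z :: mulList z add mul as b)

/-- Value at `x` of the polynomial with the given coefficients, each evaluated by `ev`. -/
def evalList (ev : α → ℝ) (x : ℝ) : List α → ℝ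
  | [] => 0
  | a :: as => ev a + x * evalList ev x as

/-- Prepend the entries of a row to the columns of a ragged array. -/
def consRow (z : α) : List α → List (List α) → List (List α)
  | [], ls => ls.map (z :: ·)
  | a :: as, [] => [a] :: consRow z as []
  | a :: as, l :: ls => (a :: l) :: consRow z as ls

/-- Transpose of a ragged array, padded with `z`. -/
def transposeList (z : α) (l : List (List α)) : List (List α) :=
  l.foldr (consRow z) []

variable {ev : α → ℝ} {x y : ℝ} {z : α} {add mul : α → α → α}

theorem evalList_add (hadd : ∀ a b, ev (add a b) = ev a + ev b) (p q : List α) :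
    evalList ev x (addList add p q) = evalList ev x p + evalList ev x q := by
  induction p generalizing q with
  | nil => simp [addList, evalList]
  | cons a p ih =>
    cases q with
    | nil => simp [addList, evalList]
    | cons b q => simp only [addList, evalList, hadd, ih]; ring

theorem evalList_map {f : α → α} {c : ℝ} (hf : ∀ a, ev (f a) = c * ev a) (p : List α) :
    evalList ev x (p.map f) = c * evalList ev x p := by
  induction p with
  | nil => simp [evalList]
  | cons a p ih => simp only [List.map_cons, evalList, hf, ih]; ring

theorem evalList_mul (hz : ev z = 0) (hadd : ∀ a b, ev (add a b) = ev a + ev b)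
    (hmul : ∀ a b, ev (mul a b) = ev a * ev b) (p q : List α) :
    evalList ev x (mulList z add mul p q) = evalList ev x p * evalList ev x q := by
  induction p with
  | nil => simp [mulList, evalList]
  | cons a p ih =>
    simp only [mulList, evalList, evalList_add hadd, evalList_map (hmul a), hz, ih]
    ring

theorem evalList_consRow (hz : ev z = 0) (r : List α) (ls : List (List α)) :
    evalList (evalList ev x) y (consRow z r ls) =
      evalList ev y r + x * evalList (evalList ev x) y ls := by
  induction r generalizing ls with
  | nil =>
    rw [consRow, evalList_map (c := x) (fun a => by simp [evalList, hz])]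
    simp [evalList]
  | cons a r ih =>
    cases ls with
    | nil => simp [consRow, evalList, ih]
    | cons l ls => simp only [consRow, evalList, ih]; ring

theorem evalList_transpose (hz : ev z = 0) (l : List (List α)) :
    evalList (evalList ev x) y (transposeList z l) = evalList (evalList ev y) x l := by
  induction l with
  | nil => simp [transposeList, evalList]
  | cons r l ih =>
    simp only [transposeList, List.foldr_cons, evalList] at ih ⊢
    rw [evalList_consRow hz, ih]

theorem evalList_congr {ev' : α → ℝ} (p : List α) (h : ∀ a, ev a = ev' a) :
    evalList ev x p = evalList ev' x p := by
  rw [funext h]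

theorem evalList_map_comp {β : Type} (ev : β → ℝ) (f : α → β) (p : List α) :
    evalList ev x (p.map f) = evalList (fun a => ev (f a)) x p := by
  induction p with
  | nil => rfl
  | cons a p ih => simp only [List.map_cons, evalList, ih]

theorem abs_evalList_le {size : α → ℕ} (hx : |x| ≤ 1) (h : ∀ a, |ev a| ≤ size a) (p : List α) :
    |evalList ev x p| ≤ ((p.map size).sum : ℕ) := by
  induction p with
  | nil => simp [evalList]
  | cons a p ih =>
    simp only [evalList, List.map_cons, List.sum_cons, Nat.cast_add]
    refine (abs_add_le _ _).trans (add_le_add (h a) ?_)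
    rw [abs_mul]
    exact (mul_le_of_le_one_left (abs_nonneg _) hx).trans ih

end CoefficientLists

/-- Integer polynomials in three variables `u`, `v`, `t`, as coefficient lists in `u` whose entries
are coefficient lists in `v` whose entries are coefficient lists in `t`. -/
abbrev Poly := List (List (List ℤ))

namespace Poly

/-- Value of a polynomial at a point. -/
def eval (u v t : ℝ) (p : Poly) : ℝ :=
  evalList (evalList (evalList (fun c : ℤ => (c : ℝ)) t) v) u p

/-- Sum of polynomials. -/
def add : Poly → Poly → Poly := addList (addList (addList Int.add))

/-- Product of polynomials. -/
def mul : Poly → Poly → Poly :=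
  mulList [] (addList (addList Int.add))
    (mulList [] (addList Int.add) (mulList 0 Int.add Int.mul))

/-- Sum of a list of polynomials. -/
def sum (l : List Poly) : Poly := l.foldr add []

/-- Constant polynomial. -/
def const (c : ℤ) : Poly := [[[c]]]

/-- Exchange of `u` and `v`. -/
def swapUV : Poly → Poly := transposeList []

/-- Exchange of `v` and `t`. -/
def swapVT (p : Poly) : Poly := p.map (transposeList 0)

/-- Sum over all permutations of the variables. -/
def symmetrize (p : Poly) : Poly :=
  sum [p, swapUV p, swapVT p, swapVT (swapUV p), swapUV (swapVT p), swapVT (swapUV (swapVT p))]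

/-- Sum of the absolute values of the coefficients. -/
def coeffNorm (p : Poly) : ℕ :=
  (p.map fun q => (q.map fun r => (r.map Int.natAbs).sum).sum).sum

/-- A polynomial in one variable, read as a polynomial in `u`. -/
def inU (w : List ℤ) : Poly := w.map fun c => [[c]]

/-- A polynomial in one variable, read as a polynomial in `v`. -/
def inV (w : List ℤ) : Poly := [w.map fun c => [c]]

/-- Substitution of two polynomials into a polynomial in two variables. -/
def subst (l o : Poly) (q : List (List ℤ)) : Poly :=
  q.foldr (fun r acc => add (r.foldr (fun c acc => add (const c) (mul l acc)) []) (mul o acc)) []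

variable (u v t : ℝ) (p q : Poly)

theorem eval_add : eval u v t (add p q) = eval u v t p + eval u v t q :=
  evalList_add (evalList_add (evalList_add Int.cast_add)) p q

theorem eval_mul : eval u v t (mul p q) = eval u v t p * eval u v t q :=
  evalList_mul (z := []) rfl (evalList_add (evalList_add Int.cast_add))
    (evalList_mul (z := []) rfl (evalList_add Int.cast_add)
      (evalList_mul Int.cast_zero Int.cast_add Int.cast_mul)) p q

@[simp] theorem eval_nil : eval u v t [] = 0 := rfl

theorem eval_sum (l : List Poly) : eval u v t (sum l) = (l.map (eval u v t)).sum := by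
  induction l with
  | nil => rfl
  | cons p l ih => simpa [sum, eval_add] using ih

@[simp] theorem eval_const (c : ℤ) : eval u v t (const c) = c := by
  simp [eval, const, evalList]

theorem eval_swapUV : eval u v t (swapUV p) = eval v u t p :=
  evalList_transpose (z := []) rfl p

theorem eval_swapVT : eval u v t (swapVT p) = eval u t v p := by
  rw [eval, swapVT, evalList_map_comp]
  exact evalList_congr p fun a => evalList_transpose Int.cast_zero a

theorem eval_symmetrize :
    eval u v t (symmetrize p) =
      eval u v t p + eval v u t p + eval u t v p + eval t u v p + eval v t u p + eval t v u p := by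
  simp only [symmetrize, eval_sum, List.map_cons, List.map_nil, List.sum_cons, List.sum_nil,
    eval_swapUV, eval_swapVT]
  ring

theorem eval_inU (w : List ℤ) :
    eval u v t (inU w) = evalList (fun c : ℤ => (c : ℝ)) u w := by
  rw [eval, inU, evalList_map_comp]
  exact evalList_congr w fun a => by simp [evalList]

theorem eval_inV (w : List ℤ) :
    eval u v t (inV w) = evalList (fun c : ℤ => (c : ℝ)) v w := by
  simp only [eval, inV, evalList, evalList_map_comp, mul_zero, add_zero]

theorem eval_subst (q : List (List ℤ)) :
    eval u v t (subst p l q) =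
      evalList (evalList (fun c : ℤ => (c : ℝ)) (eval u v t p)) (eval u v t l) q := by
  induction q with
  | nil => rfl
  | cons r q ih =>
    simp only [subst, List.foldr_cons, evalList, eval_add, eval_mul] at ih ⊢
    rw [ih]
    congr 1
    induction r with
    | nil => rfl
    | cons c r ihr => simp only [List.foldr_cons, evalList, eval_add, eval_mul, eval_const, ihr]

variable {u v t} in
theorem abs_eval_le (hu : |u| ≤ 1) (hv : |v| ≤ 1) (ht : |t| ≤ 1) :
    |eval u v t p| ≤ coeffNorm p :=
  abs_evalList_le hu (abs_evalList_le hv (abs_evalList_le ht fun c => by simp)) p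

end Poly

section PositiveKernels

/-- A function `q` of an inner product and a product of squared norms is a positive kernel when it
defines a positive semidefinite kernel on three-dimensional space. -/
def IsPositiveKernel (q : ℝ → ℝ → ℝ) : Prop :=
  ∀ {ι : Type} (s : Finset ι) (w a b c : ι → ℝ),
    0 ≤ ∑ j ∈ s, ∑ k ∈ s, w j * w k *
      q (a j * a k + b j * b k + c j * c k)
        ((a j ^ 2 + b j ^ 2 + c j ^ 2) * (a k ^ 2 + b k ^ 2 + c k ^ 2))

theorem isPositiveKernel_of_sum {n : ℕ} {q : ℝ → ℝ → ℝ} (m : Fin n → ℝ) (hm : ∀ i, 0 ≤ m i)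
    (h : Fin n → ℝ → ℝ → ℝ → ℝ)
    (hq : ∀ a b c a' b' c' : ℝ,
      q (a * a' + b * b' + c * c') ((a ^ 2 + b ^ 2 + c ^ 2) * (a' ^ 2 + b' ^ 2 + c' ^ 2)) =
        ∑ i, m i * (h i a b c * h i a' b' c')) :
    IsPositiveKernel q := by
  intro ι s w a b c
  have key : ∑ j ∈ s, ∑ k ∈ s, w j * w k *
      q (a j * a k + b j * b k + c j * c k)
        ((a j ^ 2 + b j ^ 2 + c j ^ 2) * (a k ^ 2 + b k ^ 2 + c k ^ 2)) =
      ∑ i, m i * (∑ j ∈ s, w j * h i (a j) (b j) (c j)) ^ 2 := by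
    simp only [hq]
    simp only [sq, Finset.sum_mul_sum]
    simp only [Finset.mul_sum]
    rw [Finset.sum_congr rfl fun j _ => Finset.sum_comm, Finset.sum_comm]
    exact Finset.sum_congr rfl fun i _ => Finset.sum_congr rfl fun j _ =>
      Finset.sum_congr rfl fun k _ => by ring
  rw [key]
  exact Finset.sum_nonneg fun i _ => mul_nonneg (hm i) (sq_nonneg _)

/-- Homogenized Legendre polynomials of degree `0` to `5`, up to positive factors, in an inner
product (inner lists) and a product of squared norms (outer list). -/
def legendreForms : List (List (List ℤ)) :=
  [[[1]], [[0, 1]], [[0, 0, 3], [-1]], [[0, 0, 0, 5], [0, -3]],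
    [[0, 0, 0, 0, 35], [0, 0, -30], [3]], [[0, 0, 0, 0, 0, 63], [0, 0, 0, -70], [0, 15]]]

/-- The real function defined by an element of `legendreForms`. -/
def formEval (q : List (List ℤ)) (l o : ℝ) : ℝ :=
  evalList (evalList (fun c : ℤ => (c : ℝ)) l) o q

theorem isPositiveKernel_legendreForms :
    ∀ q ∈ legendreForms, IsPositiveKernel (formEval q) := by
  simp only [legendreForms, List.forall_mem_cons, List.not_mem_nil, false_imp_iff, implies_true,
    and_true]
  refine ⟨?_, ?_, ?_, ?_, ?_, ?_⟩
  · refine isPositiveKernel_of_sum ![1] (by simp) ![fun _ _ _ => 1] fun a b c a' b' c' => ?_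
    simp [formEval, evalList]
  · refine isPositiveKernel_of_sum ![1, 1, 1] (by simp [Fin.forall_fin_succ])
      ![fun a _ _ => a, fun _ b _ => b, fun _ _ c => c] fun a b c a' b' c' => ?_
    simp [formEval, evalList, Fin.sum_univ_succ]
    ring
  · refine isPositiveKernel_of_sum ![1 / 2, 6, 6, 3 / 2, 3 / 2]
      (by simp [Fin.forall_fin_succ]; norm_num)
      ![fun a b c => 3 * c ^ 2 - (a ^ 2 + b ^ 2 + c ^ 2),
        fun a _ c => c * a, fun _ b c => c * b,
        fun a b _ => a ^ 2 - b ^ 2, fun a b _ => 2 * a * b] fun a b c a' b' c' => ?_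
    simp [formEval, evalList, Fin.sum_univ_succ]
    ring
  · refine isPositiveKernel_of_sum ![1 / 2, 3 / 4, 3 / 4, 15 / 2, 15 / 2, 5 / 4, 5 / 4]
      (by simp [Fin.forall_fin_succ]; norm_num)
      ![fun a b c => 5 * c ^ 3 - 3 * c * (a ^ 2 + b ^ 2 + c ^ 2),
        fun a b c => (5 * c ^ 2 - (a ^ 2 + b ^ 2 + c ^ 2)) * a,
        fun a b c => (5 * c ^ 2 - (a ^ 2 + b ^ 2 + c ^ 2)) * b,
        fun a b c => c * (a ^ 2 - b ^ 2), fun a b c => c * (2 * a * b),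
        fun a b _ => a ^ 3 - 3 * a * b ^ 2, fun a b _ => 3 * a ^ 2 * b - b ^ 3]
      fun a b c a' b' c' => ?_
    simp [formEval, evalList, Fin.sum_univ_succ]
    ring
  · refine isPositiveKernel_of_sum
      ![1 / 8, 5, 5, 5 / 2, 5 / 2, 35, 35, 35 / 8, 35 / 8]
      (by simp [Fin.forall_fin_succ]; norm_num)
      ![fun a b c => 35 * c ^ 4 - 30 * c ^ 2 * (a ^ 2 + b ^ 2 + c ^ 2)
          + 3 * (a ^ 2 + b ^ 2 + c ^ 2) ^ 2,
        fun a b c => (7 * c ^ 3 - 3 * c * (a ^ 2 + b ^ 2 + c ^ 2)) * a,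
        fun a b c => (7 * c ^ 3 - 3 * c * (a ^ 2 + b ^ 2 + c ^ 2)) * b,
        fun a b c => (7 * c ^ 2 - (a ^ 2 + b ^ 2 + c ^ 2)) * (a ^ 2 - b ^ 2),
        fun a b c => (7 * c ^ 2 - (a ^ 2 + b ^ 2 + c ^ 2)) * (2 * a * b),
        fun a b c => c * (a ^ 3 - 3 * a * b ^ 2), fun a b c => c * (3 * a ^ 2 * b - b ^ 3),
        fun a b _ => a ^ 4 - 6 * a ^ 2 * b ^ 2 + b ^ 4,
        fun a b _ => 4 * a ^ 3 * b - 4 * a * b ^ 3]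
      fun a b c a' b' c' => ?_
    simp [formEval, evalList, Fin.sum_univ_succ]
    ring
  · refine isPositiveKernel_of_sum
      ![1 / 8, 15 / 8, 15 / 8, 105 / 2, 105 / 2, 35 / 16, 35 / 16, 315 / 8, 315 / 8,
        63 / 16, 63 / 16]
      (by simp [Fin.forall_fin_succ]; norm_num)
      ![fun a b c => 63 * c ^ 5 - 70 * c ^ 3 * (a ^ 2 + b ^ 2 + c ^ 2)
          + 15 * c * (a ^ 2 + b ^ 2 + c ^ 2) ^ 2,
        fun a b c => (21 * c ^ 4 - 14 * c ^ 2 * (a ^ 2 + b ^ 2 + c ^ 2)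
          + (a ^ 2 + b ^ 2 + c ^ 2) ^ 2) * a,
        fun a b c => (21 * c ^ 4 - 14 * c ^ 2 * (a ^ 2 + b ^ 2 + c ^ 2)
          + (a ^ 2 + b ^ 2 + c ^ 2) ^ 2) * b,
        fun a b c => (3 * c ^ 3 - c * (a ^ 2 + b ^ 2 + c ^ 2)) * (a ^ 2 - b ^ 2),
        fun a b c => (3 * c ^ 3 - c * (a ^ 2 + b ^ 2 + c ^ 2)) * (2 * a * b),
        fun a b c => (9 * c ^ 2 - (a ^ 2 + b ^ 2 + c ^ 2)) * (a ^ 3 - 3 * a * b ^ 2),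
        fun a b c => (9 * c ^ 2 - (a ^ 2 + b ^ 2 + c ^ 2)) * (3 * a ^ 2 * b - b ^ 3),
        fun a b c => c * (a ^ 4 - 6 * a ^ 2 * b ^ 2 + b ^ 4),
        fun a b c => c * (4 * a ^ 3 * b - 4 * a * b ^ 3),
        fun a b _ => a ^ 5 - 10 * a ^ 3 * b ^ 2 + 5 * a * b ^ 4,
        fun a b _ => 5 * a ^ 4 * b - 10 * a ^ 2 * b ^ 3 + b ^ 5]
      fun a b c a' b' c' => ?_
    simp [formEval, evalList, Fin.sum_univ_succ]
    ring

end PositiveKernels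

/-- Coefficient lists of the weight functions of the Legendre kernels of degree `0` to `5`. -/
def kernelWeights : List (List (List ℤ)) :=
  [[[56169721, -60932327, 200191925, -455599918, 330046665, 2247368567, -1845791253, -939896816],
    [111514735, 432964851, -444941110, -672591791, -486841150, 0, 708041350, 493652482]],
   [[-65375108, 47756217, -205739839, 473095728, 3559937351, -728224353, -1725096662], [15287242,
    244683070, -543347586, -136326692, 0, 1909678761, 504142428], [-51182630, -845177925,
    232228172, 1313006143, 0, 0, -646793450], [-93551163, -200060466, -370518477, 0, 0, 0,
    913161493]],
   [[-212778404, -619719453, 190360471, 1827028301, 873945973, -802857365], [48169095,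
    -128336366, 515956423, 0, 748176665, 1142555589], [13703562, 41090446, 690570177, 0,
    -448582847, 0]],
   [[113404557, -57926149, -271433005, 591111138, 1306881287], [92550150, 643645031, -234967534,
    -611963378, 0]],
   [[-71373072, -135778283, 36959280, 411214436], [40876130, 140987654, -32242772, 0]],
   [[-52054512, -92077257, 169244587]]]

/-- Polynomials whose squares enter the certificate with multiplier `1`. -/
def freeSquares : List Poly :=
  [[[[-28497644, -133139390, 86502133, 340654643, 487239527, 221489147, -484596911, -427221670],
    [-133139390, -173149475, 513361791, 674588755, 22025989, -249858272, 84760144], [86502133,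
    513361791, -167057054, -1058547231, -1449289388, -401147253], [340654643, 674588755,
    -1058547231, -2297816898, -1242999828], [487239527, 22025989, -1449289388, -1242999828],
    [221489147, -249858272, -401147253], [-484596911, 84760144], [-427221670]], [[-133139390,
    -173149475, 513361791, 674588755, 22025989, -249858272, 84760144], [-173149475, 776433727,
    -840105908, -1129426321, -667084892, -53984147], [513361791, -840105908, -642494436,
    2638435228, 493481999], [674588755, -1129426321, 2638435228, -346801307], [22025989,
    -667084892, 493481999], [-249858272, -53984147], [84760144]], [[86502133, 513361791,
    -167057054, -1058547231, -1449289388, -401147253], [513361791, -840105908, -642494436,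
    2638435228, 493481999], [-167057054, -642494436, 4913442554, -3066251093], [-1058547231,
    2638435228, -3066251093], [-1449289388, 493481999], [-401147253]], [[340654643, 674588755,
    -1058547231, -2297816898, -1242999828], [674588755, -1129426321, 2638435228, -346801307],
    [-1058547231, 2638435228, -3066251093], [-2297816898, -346801307], [-1242999828]],
    [[487239527, 22025989, -1449289388, -1242999828], [22025989, -667084892, 493481999],
    [-1449289388, 493481999], [-1242999828]], [[221489147, -249858272, -401147253], [-249858272,
    -53984147], [-401147253]], [[-484596911, 84760144], [84760144]], [[-427221670]]],
   [[[-25931064, -120994348, 140076880, 697299787, -32722522, -1108734828, -490919845,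
    220909751], [-120994348, 10344759, 497639669, 127000633, -642977717, -149220579, 83963958],
    [140076880, 497639669, -525534730, -1537003762, 426601747, 410920435], [697299787, 127000633,
    -1537003762, -396566467, 202522839], [-32722522, -642977717, 426601747, 202522839],
    [-1108734828, -149220579, 410920435], [-490919845, 83963958], [220909751]], [[-120994348,
    10344759, 497639669, 127000633, -642977717, -149220579, 83963958], [10344759, 1047634954,
    -1399934351, -1072586181, -330042866, -317632109], [497639669, -1399934351, -462939032,
    2767493951, 1628486141], [127000633, -1072586181, 2767493951, -1268888250], [-642977717,
    -330042866, 1628486141], [-149220579, -317632109], [83963958]], [[140076880, 497639669,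
    -525534730, -1537003762, 426601747, 410920435], [497639669, -1399934351, -462939032,
    2767493951, 1628486141], [-525534730, -462939032, 0, -171758581], [-1537003762, 2767493951,
    -171758581], [426601747, 1628486141], [410920435]], [[697299787, 127000633, -1537003762,
    -396566467, 202522839], [127000633, -1072586181, 2767493951, -1268888250], [-1537003762,
    2767493951, -171758581], [-396566467, -1268888250], [202522839]], [[-32722522, -642977717,
    426601747, 202522839], [-642977717, -330042866, 1628486141], [426601747, 1628486141],
    [202522839]], [[-1108734828, -149220579, 410920435], [-149220579, -317632109], [410920435]],
    [[-490919845, 83963958], [83963958]], [[220909751]]],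
   [[[-305763, -9206829, -112570163, 29735923, 833068080, 324150372, -1423189290, -1041199726],
    [-9206829, 169724505, 156354593, -506277714, -584074208, -428329587, -277534442], [-112570163,
    156354593, 132424360, -23210059, -361576537, -1085635418], [29735923, -506277714, -23210059,
    2283313190, 889646008], [833068080, -584074208, -361576537, 889646008], [324150372,
    -428329587, -1085635418], [-1423189290, -277534442], [-1041199726]], [[-9206829, 169724505,
    156354593, -506277714, -584074208, -428329587, -277534442], [169724505, -276175068,
    -271442445, 995873651, 598005584, -690084341], [156354593, -271442445, 223577501, 0,
    -513560255], [-506277714, 995873651, 0, -1481554820], [-584074208, 598005584, -513560255],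
    [-428329587, -690084341], [-277534442]], [[-112570163, 156354593, 132424360, -23210059,
    -361576537, -1085635418], [156354593, -271442445, 223577501, 0, -513560255], [132424360,
    223577501, 0, 1244118424], [-23210059, 0, 1244118424], [-361576537, -513560255],
    [-1085635418]], [[29735923, -506277714, -23210059, 2283313190, 889646008], [-506277714,
    995873651, 0, -1481554820], [-23210059, 0, 1244118424], [2283313190, -1481554820],
    [889646008]], [[833068080, -584074208, -361576537, 889646008], [-584074208, 598005584,
    -513560255], [-361576537, -513560255], [889646008]], [[324150372, -428329587, -1085635418],
    [-428329587, -690084341], [-1085635418]], [[-1423189290, -277534442], [-277534442]],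
    [[-1041199726]]],
   [[[-13862054, -63749300, -2341682, 286072645, 75663399, -275440764, 529060461, 638414490],
    [-63749300, 82012186, 477664329, -32322385, -818144500, -624836935, 62986163], [-2341682,
    477664329, 867095581, -767165145, -2018193183, -1026980106], [286072645, -32322385,
    -767165145, 0, -454154240], [75663399, -818144500, -2018193183, -454154240], [-275440764,
    -624836935, -1026980106], [529060461, 62986163], [638414490]], [[-63749300, 82012186,
    477664329, -32322385, -818144500, -624836935, 62986163], [82012186, -273483782, -540477912,
    -107451068, 2153780275, 1697592935], [477664329, -540477912, 644231114, 0, -1539616433],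
    [-32322385, -107451068, 0, 393634317], [-818144500, 2153780275, -1539616433], [-624836935,
    1697592935], [62986163]], [[-2341682, 477664329, 867095581, -767165145, -2018193183,
    -1026980106], [477664329, -540477912, 644231114, 0, -1539616433], [867095581, 644231114, 0,
    618617757], [-767165145, 0, 618617757], [-2018193183, -1539616433], [-1026980106]],
    [[286072645, -32322385, -767165145, 0, -454154240], [-32322385, -107451068, 0, 393634317],
    [-767165145, 0, 618617757], [0, 393634317], [-454154240]], [[75663399, -818144500,
    -2018193183, -454154240], [-818144500, 2153780275, -1539616433], [-2018193183, -1539616433],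
    [-454154240]], [[-275440764, -624836935, -1026980106], [-624836935, 1697592935],
    [-1026980106]], [[529060461, 62986163], [62986163]], [[638414490]]],
   [[[85625, 751704, 7799139, -387664, -56341918, -29016416, 91441986, 74542086], [751704,
    -7163522, -14008681, 33523830, 45441441, -58181141, -73499486], [7799139, -14008681,
    -68413291, -3665297, 138556938, 98368388], [-387664, 33523830, -3665297, 0, 13380944],
    [-56341918, 45441441, 138556938, 13380944], [-29016416, -58181141, 98368388], [91441986,
    -73499486], [74542086]], [[751704, -7163522, -14008681, 33523830, 45441441, -58181141,
    -73499486], [-7163522, 40183187, -8645463, -64993403, 0, 20468265], [-14008681, -8645463,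
    28431822, 0, -24910385], [33523830, -64993403, 0, 15762453], [45441441, 0, -24910385],
    [-58181141, 20468265], [-73499486]], [[7799139, -14008681, -68413291, -3665297, 138556938,
    98368388], [-14008681, -8645463, 28431822, 0, -24910385], [-68413291, 28431822, 0, 2015344],
    [-3665297, 0, 2015344], [138556938, -24910385], [98368388]], [[-387664, 33523830, -3665297, 0,
    13380944], [33523830, -64993403, 0, 15762453], [-3665297, 0, 2015344], [0, 15762453],
    [13380944]], [[-56341918, 45441441, 138556938, 13380944], [45441441, 0, -24910385],
    [138556938, -24910385], [13380944]], [[-29016416, -58181141, 98368388], [-58181141, 20468265],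
    [98368388]], [[91441986, -73499486], [-73499486]], [[74542086]]]]

/-- Polynomials whose squares enter the certificate with multiplier `(1 + u) (44 - 89 u)`. -/
def rangeSquares : List Poly :=
  [[[[15224915, 65577034, -105234174, -118197560, -20583072, -80368508, -54494939], [65577034,
    92289139, -316185084, -222236525, -97342106, 3397289], [-105234174, -316185084, 589740018,
    872180299, 178953180], [-118197560, -222236525, 872180299, 193301421], [-20583072, -97342106,
    178953180], [-80368508, 3397289], [-54494939]], [[96624822, 241720496, -375819762, -315674953,
    -148313886, -72184456], [241720496, -191093160, -254263377, 118934000, -272396560],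
    [-375819762, -254263377, 1579332344, -42458055], [-315674953, 118934000, -42458055],
    [-148313886, -272396560], [-72184456]], [[184022040, 375428657, -334135393, -224708959,
    -149975238], [375428657, -121760347, -140863247, -234898861], [-334135393, -140863247,
    19780357], [-224708959, -234898861], [-149975238]], [[91688024, 249270368, -66017485,
    -77656836], [249270368, 321582340, -254522943], [-66017485, -254522943], [-77656836]],
    [[-107522919, -40356126, 25126552], [-40356126, 244910480], [25126552]], [[-59666780,
    -58185050], [-58185050]], [[37480627]]],
   [[[7001175, 18681784, -118307930, -108367822, 288573777, 319495765, 62479364], [18681784,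
    118868459, -200555859, -271438093, -172654235, -202509292], [-118307930, -200555859,
    197404360, 831352090, 87388890], [-108367822, -271438093, 831352090, 518883884], [288573777,
    -172654235, 87388890], [319495765, -202509292], [62479364]], [[70873082, 23034648, -129579361,
    -163811290, 98674529, 96580517], [23034648, -156200122, 20133437, 69000546, -85770097],
    [-129579361, 20133437, 0, 183210037], [-163811290, 69000546, 183210037], [98674529,
    -85770097], [96580517]], [[235742123, -92694082, -204182593, -234153512, -101342786],
    [-92694082, -327249841, 53949381, 283184521], [-204182593, 53949381, -50164782], [-234153512,
    283184521], [-101342786]], [[148979568, -199775785, -63533730, -7494778], [-199775785,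
    189447337, -168365369], [-63533730, -168365369], [-7494778]], [[-95985217, 44239520,
    66982627], [44239520, 286743380], [66982627]], [[37109990, 121547216], [121547216]],
    [[127644161]]],
   [[[3516264, 21281269, 15419667, -58634820, -96002656, -95452252, -51503964], [21281269,
    -14945149, -41611156, 54914160, 117844707, -9655321], [15419667, -41611156, 50634095, 0,
    -74575458], [-58634820, 54914160, 0, -970543], [-96002656, 117844707, -74575458], [-95452252,
    -9655321], [-51503964]], [[10671454, 79751587, -30366654, -369739171, -131108655, 49398683],
    [79751587, -27948220, -128169054, 329559241, 484604984], [-30366654, -128169054, 0,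
    -162610723], [-369739171, 329559241, -162610723], [-131108655, 484604984], [49398683]],
    [[-38247238, 53621785, -118106381, -471325334, 110643048], [53621785, 330509353, -13973387,
    95267270], [-118106381, -13973387, -8959177], [-471325334, 95267270], [110643048]],
    [[-109943084, -75204819, -70834110, -217264111], [-75204819, 249142034, 95117457], [-70834110,
    95117457], [-217264111]], [[-14688107, -74815367, -90458825], [-74815367, -112852202],
    [-90458825]], [[103517003, -699871], [-699871]], [[58118989]]],
   [[[2805398, 23583528, 61856308, -127982476, -265160961, 17495328, 129952018], [23583528,
    -30953129, -22396877, 18252791, 226146984, 196785960], [61856308, -22396877, -175713227, 0,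
    121835426], [-127982476, 18252791, 0, -17570343], [-265160961, 226146984, 121835426],
    [17495328, 196785960], [129952018]], [[2786263, 13509100, -34494720, -172630277, -167133883,
    -81250566], [13509100, 64017072, 112505665, -67177826, 0], [-34494720, 112505665, 0,
    264387421], [-172630277, -67177826, 264387421], [-167133883, 0], [-81250566]], [[-64511252,
    -72462539, -82597755, 30668015, -10111931], [-72462539, 331356586, 165669801, -337533903],
    [-82597755, 165669801, 408722776], [30668015, -337533903], [-10111931]], [[-48234688,
    63637885, 96520059, -87732713], [63637885, 159097051, -7599965], [96520059, -7599965],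
    [-87732713]], [[117747832, 226545719, 62245889], [226545719, 2928332], [62245889]],
    [[73970629, 105146453], [105146453]], [[-34214390]]],
   [[[2110066, 16112650, 27300961, -56184146, -133673361, -44477840, 25365279], [16112650,
    15273936, 14472898, -21337958, -49210793, -25162202], [27300961, 14472898, -15380456, 0,
    -9273033], [-56184146, -21337958, 0, -33153311], [-133673361, -49210793, -9273033],
    [-44477840, -25162202], [25365279]], [[2524868, 18160778, -5958410, -125620439, -190197216,
    -108407916], [18160778, -22227742, 62857237, 36028359, 0], [-5958410, 62857237, 0, -22783945],
    [-125620439, 36028359, -22783945], [-190197216, 0], [-108407916]], [[-43236933, -78812529,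
    -88075608, -30950934, 36450742], [-78812529, -4103488, 36766674, -41369682], [-88075608,
    36766674, 0], [-30950934, -41369682], [36450742]], [[-31962624, -111052082, -53435997,
    -59255683], [-111052082, -45502133, -115037292], [-53435997, -115037292], [-59255683]],
    [[167615720, -45270394, -27114591], [-45270394, -44949167], [-27114591]], [[284922960,
    4844501], [4844501]], [[128004233]]]]

/-- Polynomials whose squares enter the certificate with the Gram determinant as multiplier. -/
def gramSquares : List Poly :=
  [[[[22369670, 115381652, -58835065, 24300870, -484771176, -618250291], [115381652, 618816906,
    -65100425, -1285983674, -1341839450], [-58835065, -65100425, 1097333160, 105927944],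
    [24300870, -1285983674, 105927944], [-484771176, -1341839450], [-618250291]], [[115381652,
    618816906, -65100425, -1285983674, -1341839450], [618816906, 1024756905, -593588670,
    -2285935766], [-65100425, -593588670, 2768970077], [-1285983674, -2285935766], [-1341839450]],
    [[-58835065, -65100425, 1097333160, 105927944], [-65100425, -593588670, 2768970077],
    [1097333160, 2768970077], [105927944]], [[24300870, -1285983674, 105927944], [-1285983674,
    -2285935766], [105927944]], [[-484771176, -1341839450], [-1341839450]], [[-618250291]]]]

/-- The part of the certificate coming from the kernel with form `q` and weights `ws`. -/
def kernelPart (q : List (List ℤ)) (ws : List (List ℤ)) : Poly :=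
  Poly.add
    (Poly.mul (Poly.mul (Poly.const 22) (Poly.subst [[[0, 1]], [[], [-1]]]
        (Poly.mul [[[1]], [], [[-1]]] [[[1], [], [-1]]]) q))
      (Poly.sum (ws.map fun w => Poly.mul (Poly.inU w) (Poly.inV w))))
    (Poly.mul (Poly.subst [[[1]], [], [[-1]]] [[[1]], [], [[-2]], [], [[1]]] q)
      (Poly.sum (ws.map fun w => Poly.mul (Poly.inU w) (Poly.inU w))))

/-- The multiplier `(1 + u) (44 - 89 u)`. -/
def rangeMultiplier : Poly := [[[44]], [[-45]], [[-89]]]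

/-- The Gram determinant `1 + 2 u v t - u ^ 2 - v ^ 2 - t ^ 2`. -/
def gramMultiplier : Poly := [[[1, 0, -1], [], [-1]], [[], [0, 2]], [[-1]]]

/-- Sum of the kernel parts of the certificate. -/
def kernelSum : Poly := Poly.sum (List.zipWith kernelPart legendreForms kernelWeights)

/-- Sum of squares of polynomials. -/
def sumSquares (l : List Poly) : Poly := Poly.sum (l.map fun p => Poly.mul p p)

/-- The weighted sum of squares of the certificate. -/
def squaresSum : Poly :=
  Poly.add (sumSquares freeSquares)
    (Poly.add (Poly.mul rangeMultiplier (sumSquares rangeSquares))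
      (Poly.mul gramMultiplier (sumSquares gramSquares)))

theorem coeffNorm_certificate :
    Poly.coeffNorm (Poly.add (Poly.symmetrize (Poly.add kernelSum squaresSum))
      (Poly.const 2600000000000000)) < 2600000000000000 := by
  decide +kernel

section TripleSums

variable {ι : Type} [Fintype ι] [DecidableEq ι] {u : ι → ι → ℝ}

/-- Sum of `g (u i j) (u i k) (u j k)` over triples of distinct indices. -/
def tripleSum (u : ι → ι → ℝ) (g : ℝ → ℝ → ℝ → ℝ) : ℝ :=
  ∑ i, ∑ j ∈ Finset.univ.erase i, ∑ k ∈ (Finset.univ.erase i).erase j, g (u i j) (u i k) (u j k)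

theorem tripleSum_add (g h : ℝ → ℝ → ℝ → ℝ) :
    tripleSum u (fun a b c => g a b c + h a b c) = tripleSum u g + tripleSum u h := by
  simp only [tripleSum, Finset.sum_add_distrib]

theorem tripleSum_list_sum_nonneg {β : Type} (l : List β) (g : β → ℝ → ℝ → ℝ → ℝ)
    (h : ∀ b ∈ l, 0 ≤ tripleSum u (g b)) :
    0 ≤ tripleSum u fun x y z => (l.map fun b => g b x y z).sum := by
  induction l with
  | nil => simp [tripleSum]
  | cons b l ih =>
    simp only [List.map_cons, List.sum_cons, tripleSum_add]
    exact add_nonneg (h b (by simp)) (ih fun c hc => h c (by simp [hc]))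

theorem tripleSum_nonneg {g : ℝ → ℝ → ℝ → ℝ}
    (h : ∀ i j k, i ≠ j → i ≠ k → j ≠ k → 0 ≤ g (u i j) (u i k) (u j k)) :
    0 ≤ tripleSum u g :=
  Finset.sum_nonneg fun i _ => Finset.sum_nonneg fun j hj => Finset.sum_nonneg fun k hk => by
    simp only [Finset.mem_erase, Finset.mem_univ, and_true] at hj hk
    exact h i j k hj.symm hk.2.symm hk.1.symm

theorem tripleSum_neg (hcard : 2 < Fintype.card ι) {g : ℝ → ℝ → ℝ → ℝ}
    (h : ∀ i j k, g (u i j) (u i k) (u j k) < 0) : tripleSum u g < 0 := by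
  have hi (i : ι) : (Finset.univ.erase i).card = Fintype.card ι - 1 := by
    rw [Finset.card_erase_of_mem (Finset.mem_univ i), Finset.card_univ]
  refine Finset.sum_neg (fun i _ => Finset.sum_neg (fun j hj => Finset.sum_neg
    (fun k _ => h i j k) ?_) ?_) ?_ <;> rw [← Finset.card_pos]
  · rw [Finset.card_erase_of_mem hj, hi]; omega
  · rw [hi]; omega
  · rw [Finset.card_univ]; omega

theorem tripleSum_swap_right (hu : ∀ i j, u i j = u j i) (g : ℝ → ℝ → ℝ → ℝ) :
    tripleSum u (fun a b c => g b a c) = tripleSum u g := by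
  refine Finset.sum_congr rfl fun i _ => ?_
  rw [Finset.sum_comm' (t' := Finset.univ.erase i) (s' := fun k => (Finset.univ.erase i).erase k)
    (by simp only [Finset.mem_erase]; tauto)]
  exact Finset.sum_congr rfl fun j _ => Finset.sum_congr rfl fun k _ => by rw [hu k j]

theorem tripleSum_swap_left (hu : ∀ i j, u i j = u j i) (g : ℝ → ℝ → ℝ → ℝ) :
    tripleSum u (fun a b c => g a c b) = tripleSum u g := by
  unfold tripleSum
  rw [Finset.sum_comm' (t' := Finset.univ) (s' := fun j => Finset.univ.erase j)
    (by simp [eq_comm])]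
  refine Finset.sum_congr rfl fun i _ => Finset.sum_congr rfl fun j _ => ?_
  rw [Finset.erase_right_comm]
  exact Finset.sum_congr rfl fun k _ => by rw [hu j i]

theorem tripleSum_symmetrize (hu : ∀ i j, u i j = u j i) (p : Poly) :
    tripleSum u (fun a b c => Poly.eval a b c (Poly.symmetrize p)) =
      6 * tripleSum u fun a b c => Poly.eval a b c p := by
  have h₁ (g) := tripleSum_swap_right hu g
  have h₂ (g) := tripleSum_swap_left hu g
  simp only [Poly.eval_symmetrize, tripleSum_add]
  rw [h₁ fun a b c => Poly.eval a b c p, h₂ fun a b c => Poly.eval a b c p,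
    h₁ fun a b c => Poly.eval a c b p, h₂ fun a b c => Poly.eval a b c p,
    h₂ fun a b c => Poly.eval b a c p, h₁ fun a b c => Poly.eval a b c p,
    h₁ fun a b c => Poly.eval c a b p, h₂ fun a b c => Poly.eval b a c p,
    h₁ fun a b c => Poly.eval a b c p]
  ring

theorem tripleSum_kernel_nonneg (hcard : Fintype.card ι = 24) (hself : ∀ i, u i i = 1)
    (K : ℝ → ℝ → ℝ → ℝ)
    (hK : ∀ i, 0 ≤ ∑ j ∈ Finset.univ.erase i, ∑ k ∈ Finset.univ.erase i,
      K (u i j) (u i k) (u j k)) :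
    0 ≤ tripleSum u fun a b c => 22 * K a b c + K a a 1 := by
  have key : (tripleSum u fun a b c => 22 * K a b c + K a a 1) =
      ∑ i, 22 * ∑ j ∈ Finset.univ.erase i, ∑ k ∈ Finset.univ.erase i,
        K (u i j) (u i k) (u j k) := by
    refine Finset.sum_congr rfl fun i _ => ?_
    rw [Finset.mul_sum]
    refine Finset.sum_congr rfl fun j hj => ?_
    rw [← Finset.add_sum_erase _ _ hj, Finset.sum_add_distrib, Finset.sum_const,
      Finset.card_erase_of_mem hj, Finset.card_erase_of_mem (Finset.mem_univ i),
      Finset.card_univ, hcard, hself, ← Finset.mul_sum]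
    norm_num
    ring
  rw [key]
  exact Finset.sum_nonneg fun i _ => mul_nonneg (by norm_num) (hK i)

theorem tripleSum_kernelPart_nonneg (hcard : Fintype.card ι = 24) (hself : ∀ i, u i i = 1)
    (hcoord : ∀ i, ∃ a b c : ι → ℝ, ∀ j k,
      u j k = u i j * u i k + (a j * a k + b j * b k + c j * c k))
    {q : List (List ℤ)} (hq : IsPositiveKernel (formEval q)) (ws : List (List ℤ)) :
    0 ≤ tripleSum u fun a b c => Poly.eval a b c (kernelPart q ws) := by
  let W (w : List ℤ) (x : ℝ) : ℝ := evalList (fun c : ℤ => (c : ℝ)) x w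
  let K (w : List ℤ) (x y z : ℝ) : ℝ :=
    W w x * W w y * formEval q (z - x * y) ((1 - x ^ 2) * (1 - y ^ 2))
  have hL (x y z : ℝ) : Poly.eval x y z [[[0, 1]], [[], [-1]]] = z - x * y := by
    simp [Poly.eval, evalList]; ring
  have hO (x y z : ℝ) : Poly.eval x y z [[[1]], [], [[-1]]] = 1 - x ^ 2 := by
    simp [Poly.eval, evalList]; ring
  have hO' (x y z : ℝ) : Poly.eval x y z [[[1], [], [-1]]] = 1 - y ^ 2 := by
    simp [Poly.eval, evalList]; ring
  have hO'' (x y z : ℝ) :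
      Poly.eval x y z [[[1]], [], [[-2]], [], [[1]]] = (1 - x ^ 2) * (1 - x ^ 2) := by
    simp [Poly.eval, evalList]; ring
  have heval (x y z : ℝ) : Poly.eval x y z (kernelPart q ws) =
      (ws.map fun w => 22 * K w x y z + K w x x 1).sum := by
    simp only [kernelPart, Poly.eval_add, Poly.eval_mul, Poly.eval_subst, Poly.eval_const,
      Poly.eval_sum, List.map_map, hL, hO, hO', hO'', Function.comp_def, Poly.eval_inU,
      Poly.eval_inV, List.sum_map_add, List.sum_map_mul_left, List.sum_map_mul_right, K, W,
      formEval]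
    push_cast
    ring_nf
  simp only [heval]
  refine tripleSum_list_sum_nonneg ws (fun w x y z => 22 * K w x y z + K w x x 1) fun w _ =>
    tripleSum_kernel_nonneg hcard hself (K w) fun i => ?_
  obtain ⟨a, b, c, habc⟩ := hcoord i
  convert hq (Finset.univ.erase i) (fun j => W w (u i j)) a b c using 4 with j _ k _
  have hj := habc j j
  have hk := habc k k
  rw [hself] at hj hk
  congr 1
  · linarith [habc j k]
  · rw [show 1 - u i j ^ 2 = a j ^ 2 + b j ^ 2 + c j ^ 2 by linarith,
      show 1 - u i k ^ 2 = a k ^ 2 + b k ^ 2 + c k ^ 2 by linarith]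

theorem tripleSum_kernelSum_nonneg (hcard : Fintype.card ι = 24) (hself : ∀ i, u i i = 1)
    (hcoord : ∀ i, ∃ a b c : ι → ℝ, ∀ j k,
      u j k = u i j * u i k + (a j * a k + b j * b k + c j * c k)) :
    0 ≤ tripleSum u fun a b c => Poly.eval a b c kernelSum := by
  simp only [kernelSum, Poly.eval_sum, ← List.map_uncurry_zip_eq_zipWith, List.map_map,
    Function.comp_def]
  refine tripleSum_list_sum_nonneg _ (fun b x y z =>
    Poly.eval x y z (Function.uncurry kernelPart b)) fun b hb => ?_
  exact tripleSum_kernelPart_nonneg hcard hself hcoord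
    (isPositiveKernel_legendreForms b.1 (List.of_mem_zip hb).1) b.2

end TripleSums

theorem eval_sumSquares_nonneg (u v t : ℝ) (l : List Poly) :
    0 ≤ Poly.eval u v t (sumSquares l) := by
  rw [sumSquares, Poly.eval_sum, List.map_map]
  refine List.sum_nonneg fun x hx => ?_
  obtain ⟨p, -, rfl⟩ := List.mem_map.1 hx
  simpa only [Function.comp_apply, Poly.eval_mul] using mul_self_nonneg _

theorem eval_squaresSum_nonneg {u v t : ℝ} (hu : -1 ≤ u) (hu' : u ≤ 44 / 89)
    (hgram : 0 ≤ 1 + 2 * u * v * t - u ^ 2 - v ^ 2 - t ^ 2) :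
    0 ≤ Poly.eval u v t squaresSum := by
  have h₁ : Poly.eval u v t rangeMultiplier = (1 + u) * (44 - 89 * u) := by
    simp [Poly.eval, rangeMultiplier, evalList]; ring
  have h₂ : Poly.eval u v t gramMultiplier = 1 + 2 * u * v * t - u ^ 2 - v ^ 2 - t ^ 2 := by
    simp [Poly.eval, gramMultiplier, evalList]; ring
  simp only [squaresSum, Poly.eval_add, Poly.eval_mul, h₁, h₂]
  have h₃ : 0 ≤ (1 + u) * (44 - 89 * u) := mul_nonneg (by linarith) (by linarith)
  have h₄ := eval_sumSquares_nonneg u v t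
  exact add_nonneg (h₄ _) (add_nonneg (mul_nonneg h₃ (h₄ _)) (mul_nonneg hgram (h₄ _)))

theorem eval_certificate_neg {u v t : ℝ} (hu : |u| ≤ 1) (hv : |v| ≤ 1) (ht : |t| ≤ 1) :
    Poly.eval u v t (Poly.symmetrize (Poly.add kernelSum squaresSum)) < 0 := by
  have h := (le_abs_self _).trans_lt ((Poly.abs_eval_le _ hu hv ht).trans_lt
    (Nat.cast_lt.2 coeffNorm_certificate))
  rw [Poly.eval_add, Poly.eval_const] at h
  push_cast at h
  linarith

theorem exists_coordinates {x : EuclideanSpace ℝ (Fin 4)} (hx : ‖x‖ = 1) :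
    ∃ a b c : EuclideanSpace ℝ (Fin 4) → ℝ, ∀ y z,
      ⟪y, z⟫ = ⟪x, y⟫ * ⟪x, z⟫ + (a y * a z + b y * b z + c y * c z) := by
  have hs : Orthonormal ℝ (({0} : Set (Fin 4)).domRestrict fun _ => x) :=
    ⟨fun _ => hx, fun i j hij => (hij (Subsingleton.elim i j)).elim⟩
  obtain ⟨e, he⟩ := hs.exists_orthonormalBasis_extension_of_card_eq (by simp)
  refine ⟨fun y => ⟪e 1, y⟫, fun y => ⟪e 2, y⟫, fun y => ⟪e 3, y⟫, fun y z => ?_⟩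
  rw [← e.sum_inner_mul_inner y z, Fin.sum_univ_four, he 0 rfl]
  simp only [real_inner_comm]
  ring

theorem gram_nonneg {x y z : EuclideanSpace ℝ (Fin 4)} (hx : ‖x‖ = 1) (hy : ‖y‖ = 1)
    (hz : ‖z‖ = 1) :
    0 ≤ 1 + 2 * ⟪x, y⟫ * ⟪x, z⟫ * ⟪y, z⟫ - ⟪x, y⟫ ^ 2 - ⟪x, z⟫ ^ 2 - ⟪y, z⟫ ^ 2 := by
  obtain ⟨a, b, c, h⟩ := exists_coordinates hx
  have hyy := h y y
  have hzz := h z z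
  rw [real_inner_self_eq_norm_sq, hy] at hyy
  rw [real_inner_self_eq_norm_sq, hz] at hzz
  have key : 1 + 2 * ⟪x, y⟫ * ⟪x, z⟫ * ⟪y, z⟫ - ⟪x, y⟫ ^ 2 - ⟪x, z⟫ ^ 2 - ⟪y, z⟫ ^ 2 =
      (1 - ⟪x, y⟫ ^ 2) * (1 - ⟪x, z⟫ ^ 2) - (⟪y, z⟫ - ⟪x, y⟫ * ⟪x, z⟫) ^ 2 := by ring
  rw [key, show 1 - ⟪x, y⟫ ^ 2 = a y ^ 2 + b y ^ 2 + c y ^ 2 by linarith,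
    show 1 - ⟪x, z⟫ ^ 2 = a z ^ 2 + b z ^ 2 + c z ^ 2 by linarith, h y z]
  linarith [sq_nonneg (a y * b z - b y * a z), sq_nonneg (a y * c z - c y * a z),
    sq_nonneg (b y * c z - c y * b z)]

theorem cos_lt : Real.cos (60.38 * π / 180) < 44 / 89 := by
  have hπ := Real.pi_gt_d2
  have hπ' := Real.pi_lt_d2
  set δ := 19 * π / 9000 with hδ
  have h₁ : 60.38 * π / 180 = π / 3 + δ := by rw [hδ]; ring
  have h₂ := Real.sin_gt_sub_cube (x := δ) (by rw [hδ]; positivity)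
  have h₃ : δ ^ 3 ≤ (1 / 100) ^ 3 := by
    apply pow_le_pow_left₀ <;> rw [hδ] <;> linarith
  have h₄ : (1.73 : ℝ) ≤ √3 := Real.le_sqrt_of_sq_le (by norm_num)
  have h₅ : (0.0066 : ℝ) ≤ Real.sin δ := by rw [hδ] at *; linarith
  rw [h₁, Real.cos_add, Real.cos_pi_div_three, Real.sin_pi_div_three]
  nlinarith [Real.cos_le_one δ]

end SphereCode

open SphereCode

/-- Any 24 distinct unit vectors in ℝ^4 contain a pair at angular distance
at most 60.38 degrees. -/
theorem sphere_code_dim4_N24 (x : Fin 24 → EuclideanSpace ℝ (Fin 4))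
    (hx : ∀ i, ‖x i‖ = 1) (hinj : Function.Injective x) :
    ∃ i j, i ≠ j ∧ ⟪x i, x j⟫ ≥ Real.cos (60.38 * π / 180) := by
  by_contra! h
  let u (i j : Fin 24) : ℝ := ⟪x i, x j⟫
  have hself (i) : u i i = 1 := by simp [u, hx]
  have hcomm (i j) : u i j = u j i := real_inner_comm _ _
  have habs (i j) : |u i j| ≤ 1 := by
    simpa [hx] using abs_real_inner_le_norm (x i) (x j)
  have hcoord (i) : ∃ a b c : Fin 24 → ℝ, ∀ j k,
      u j k = u i j * u i k + (a j * a k + b j * b k + c j * c k) := by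
    obtain ⟨a, b, c, habc⟩ := exists_coordinates (hx i)
    exact ⟨a ∘ x, b ∘ x, c ∘ x, fun j k => habc (x j) (x k)⟩
  have hkernel := tripleSum_kernelSum_nonneg (by simp) hself hcoord
  have hsquares : 0 ≤ tripleSum u fun a b c => Poly.eval a b c squaresSum :=
    tripleSum_nonneg fun i j k hij _ _ => eval_squaresSum_nonneg (abs_le.1 (habs i j)).1
      ((h i j hij).trans cos_lt).le (gram_nonneg (hx i) (hx j) (hx k))
  have hneg := tripleSum_neg (u := u) (g := fun a b c =>
    Poly.eval a b c (Poly.symmetrize (Poly.add kernelSum squaresSum))) (by simp) fun i j k =>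
      eval_certificate_neg (habs i j) (habs i k) (habs j k)
  rw [tripleSum_symmetrize hcomm] at hneg
  simp only [Poly.eval_add, tripleSum_add] at hneg
  linarith
end

section
/- Any 11 distinct unit vectors x_1, …, x_11 in ℝ^5 contain a pair i ≠ j whose angular distance is at most 85.39 degrees; that is, there exist i ≠ j with ⟨x_i, x_j⟩ ≥ cos(85.39·π/180). Equivalently, there is no spherical (5, 11, α)-code with cos α < cos(85.39·π/180). -/
open scoped RealInnerProductSpace BigOperators
open Real

/-- The second frame potential of a finite family of unit vectors is at least its value for a
tight frame. -/
theorem sq_card_le_mul_sum_sq_inner {ι κ : Type*} [Fintype ι] [Fintype κ]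
    (x : ι → EuclideanSpace ℝ κ) (hx : ∀ i, ‖x i‖ = 1) :
    (Fintype.card ι : ℝ) ^ 2 ≤ Fintype.card κ * ∑ i, ∑ j, ⟪x i, x j⟫ ^ 2 := by
  have htrace : ∑ a, ∑ i, x i a ^ 2 = (Fintype.card ι : ℝ) := by
    rw [Finset.sum_comm]
    simp [← EuclideanSpace.real_norm_sq_eq, hx]
  have hframe : ∑ i, ∑ j, ⟪x i, x j⟫ ^ 2 = ∑ a, ∑ b, (∑ i, x i a * x i b) ^ 2 := by
    calc ∑ i, ∑ j, ⟪x i, x j⟫ ^ 2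
        = ∑ p : ι × ι, ∑ c : κ × κ, x p.1 c.1 * x p.1 c.2 * (x p.2 c.1 * x p.2 c.2) := by
          simp only [PiLp.inner_apply, RCLike.inner_apply, conj_trivial, sq, Finset.sum_mul_sum,
            Fintype.sum_prod_type]
          congr! 4
          ring
      _ = ∑ a, ∑ b, (∑ i, x i a * x i b) ^ 2 := by
          rw [Finset.sum_comm]
          simp only [sq, Finset.sum_mul_sum, Fintype.sum_prod_type]
  calc (Fintype.card ι : ℝ) ^ 2 = (∑ a, ∑ i, x i a ^ 2) ^ 2 := by rw [htrace]
    _ ≤ Fintype.card κ * ∑ a, (∑ i, x i a ^ 2) ^ 2 := sq_sum_le_card_mul_sum_sq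
    _ ≤ Fintype.card κ * ∑ i, ∑ j, ⟪x i, x j⟫ ^ 2 := by
      rw [hframe]
      gcongr with a
      simpa only [sq] using Finset.single_le_sum
        (f := fun b => (∑ i, x i a * x i b) ^ 2) (fun b _ => sq_nonneg _) (Finset.mem_univ a)

/-- Positive semidefiniteness of the Gram matrix of the projections to the orthogonal complement of
a unit vector. -/
theorem sum_mul_projected_inner_nonneg {ι E : Type*} [NormedAddCommGroup E]
    [InnerProductSpace ℝ E] (s : Finset ι) (x : ι → E) (e : E) (he : ‖e‖ = 1) (w : ι → ℝ) :
    0 ≤ ∑ j ∈ s, ∑ k ∈ s, w j * w k * (⟪x j, x k⟫ - ⟪e, x j⟫ * ⟪e, x k⟫) := by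
  have h := real_inner_self_nonneg (x := ∑ j ∈ s, w j • (x j - ⟪e, x j⟫ • e))
  rw [sum_inner] at h
  refine h.trans_eq (Finset.sum_congr rfl fun j _ => ?_)
  rw [inner_sum]
  refine Finset.sum_congr rfl fun k _ => ?_
  simp only [inner_smul_left, inner_smul_right, inner_sub_left, inner_sub_right,
    real_inner_self_eq_norm_sq, he, real_inner_comm e, conj_trivial]
  ring

/-- The quadratic weight applied to inner products with a fixed vector. -/
noncomputable def quadWeight (u : ℝ) : ℝ := u ^ 2 - 3 / 25 * u - 1 / 8

/-- The linear weight applied to inner products with a fixed vector. -/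
noncomputable def linWeight (u : ℝ) : ℝ := u - 3 / 25

/-- The three-point kernel, as a function of the inner products `u = ⟪x, y⟫`, `v = ⟪x, z⟫` and
`t = ⟪y, z⟫`. -/
noncomputable def kernel (u v t : ℝ) : ℝ :=
  quadWeight u * quadWeight v + linWeight u * linWeight v * (t - u * v)

/-- The three-point kernel together with the share of the two-point terms belonging to a triple in
a family of eleven points. -/
noncomputable def tripleKernel (u v t : ℝ) : ℝ :=
  kernel u v t + kernel u u 1 / 9 + (u ^ 2 - 3 / 25) / 6

theorem tripleKernel_cyclic_sum_neg {u v t : ℝ} (hu : -1 ≤ u) (hv : -1 ≤ v) (ht : -1 ≤ t)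
    (hu' : u ≤ 161 / 2000) (hv' : v ≤ 161 / 2000) (ht' : t ≤ 161 / 2000) :
    tripleKernel u v t + tripleKernel t u v + tripleKernel v t u < 0 := by
  have hform (a b : ℝ) : 0 ≤ 2 * (1 + a + b) ^ 2 + 7 * (a - 4 / 7 * b) ^ 2 + 110 / 7 * b ^ 2 := by
    positivity
  have box {a : ℝ} (h : -1 ≤ a) (h' : a ≤ 161 / 2000) : 0 ≤ (1 + a) * (161 / 2000 - a) :=
    mul_nonneg (by linarith) (by linarith)
  have hprod : 0 ≤ (161 / 2000 - u) * (161 / 2000 - v) * (161 / 2000 - t) :=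
    mul_nonneg (mul_nonneg (by linarith) (by linarith)) (by linarith)
  have h₁ := sq_nonneg (u * v + v * t + u * t - 1 / 11 * (u ^ 2 + v ^ 2 + t ^ 2)
    + 12873 / 88000 * (u + v + t) - 13968179 / 176000000)
  have h₂ := sq_nonneg (u ^ 2 + v ^ 2 + t ^ 2 + 141467 / 194000 * (u + v + t)
    - 201694179 / 776000000)
  have h₃ := sq_nonneg (u + v + t + 55968653341 / 401208850000)
  have h₄ := mul_nonneg (box hu hu') (hform u (v + t))
  have h₅ := mul_nonneg (box hv hv') (hform v (t + u))
  have h₆ := mul_nonneg (box ht ht') (hform t (u + v))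
  unfold tripleKernel kernel quadWeight linWeight
  linarith

/-- Summation over pairs from a finite set, the diagonal being spread over the off-diagonal
pairs. -/
theorem sum_sum_eq_sum_sum_erase {ι : Type*} [DecidableEq ι] {s : Finset ι} {n : ℕ}
    (hs : s.card = n + 1) (hn : n ≠ 0) (f : ι → ι → ℝ) :
    ∑ j ∈ s, ∑ k ∈ s, f j k = ∑ j ∈ s, ∑ k ∈ s.erase j, (f j k + f j j / n) := by
  refine Finset.sum_congr rfl fun j hj => ?_
  rw [← Finset.sum_erase_add _ _ hj, Finset.sum_add_distrib, Finset.sum_const,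
    Finset.card_erase_of_mem hj, hs, nsmul_eq_mul, Nat.add_sub_cancel]
  field_simp

section TripleSums

variable {ι : Type*} [Fintype ι] [DecidableEq ι]

/-- The sum of a function over all ordered triples of distinct elements. -/
def tripleSum (f : ι → ι → ι → ℝ) : ℝ :=
  ∑ i, ∑ j, ∑ k, if i ≠ j ∧ j ≠ k ∧ k ≠ i then f i j k else 0

theorem sum_erase_eq_tripleSum (f : ι → ι → ι → ℝ) :
    ∑ i, ∑ j ∈ Finset.univ.erase i, ∑ k ∈ (Finset.univ.erase i).erase j, f i j k
      = tripleSum f := by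
  refine Finset.sum_congr rfl fun i _ => ?_
  rw [← Finset.filter_ne, Finset.sum_filter]
  refine Finset.sum_congr rfl fun j _ => ?_
  split_ifs with hij
  · rw [← Finset.filter_ne, Finset.filter_filter, Finset.sum_filter]
    refine Finset.sum_congr rfl fun k _ => if_congr ?_ rfl rfl
    tauto
  · simp [hij]

theorem tripleSum_rotate (f : ι → ι → ι → ℝ) :
    tripleSum (fun i j k => f j k i) = tripleSum f := by
  unfold tripleSum
  rw [Finset.sum_comm]
  refine Finset.sum_congr rfl fun j _ => ?_
  rw [Finset.sum_comm]
  refine Finset.sum_congr rfl fun k _ => Finset.sum_congr rfl fun i _ => if_congr ?_ rfl rfl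
  tauto

theorem tripleSum_add (f g : ι → ι → ι → ℝ) :
    tripleSum (fun i j k => f i j k + g i j k) = tripleSum f + tripleSum g := by
  simp only [tripleSum, ← Finset.sum_add_distrib]
  refine Finset.sum_congr rfl fun i _ => Finset.sum_congr rfl fun j _ =>
    Finset.sum_congr rfl fun k _ => ?_
  split_ifs <;> simp

/-- A function on triples of distinct elements with negative cyclic sums has a negative sum. -/
theorem tripleSum_neg (hι : 3 ≤ Fintype.card ι) {f : ι → ι → ι → ℝ}
    (hf : ∀ i j k, i ≠ j → j ≠ k → k ≠ i → f i j k + f j k i + f k i j < 0) :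
    tripleSum f < 0 := by
  have hthree : 3 * tripleSum f
      = tripleSum (fun i j k => f i j k + f j k i + f k i j) := by
    rw [tripleSum_add, tripleSum_add, tripleSum_rotate,
      tripleSum_rotate (fun i j k => f j k i), tripleSum_rotate]
    ring
  have hle (i j k : ι) :
      (if i ≠ j ∧ j ≠ k ∧ k ≠ i then f i j k + f j k i + f k i j else 0) ≤ 0 := by
    split_ifs with h
    · exact (hf i j k h.1 h.2.1 h.2.2).le
    · exact le_rfl
  obtain ⟨a, b, c, hab, hac, hbc⟩ := Fintype.two_lt_card_iff.mp hι
  have hneg : tripleSum (fun i j k => f i j k + f j k i + f k i j) < 0 := by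
    refine Finset.sum_neg' (fun i _ => Finset.sum_nonpos fun j _ => Finset.sum_nonpos fun k _ =>
      hle i j k) ⟨a, Finset.mem_univ a, ?_⟩
    refine Finset.sum_neg' (fun j _ => Finset.sum_nonpos fun k _ => hle a j k)
      ⟨b, Finset.mem_univ b, ?_⟩
    refine Finset.sum_neg' (fun k _ => hle a b k) ⟨c, Finset.mem_univ c, ?_⟩
    rw [if_pos ⟨hab, hbc, hac.symm⟩]
    exact hf a b c hab hbc hac.symm
  linarith

end TripleSums

theorem tripleSum_tripleKernel_nonneg (x : Fin 11 → EuclideanSpace ℝ (Fin 5))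
    (hx : ∀ i, ‖x i‖ = 1) :
    0 ≤ tripleSum fun i j k => tripleKernel ⟪x i, x j⟫ ⟪x i, x k⟫ ⟪x j, x k⟫ := by
  have hcard (i : Fin 11) : (Finset.univ.erase i).card = 9 + 1 := by simp
  have hself (i : Fin 11) : ⟪x i, x i⟫ = (1 : ℝ) := by
    rw [real_inner_self_eq_norm_sq, hx, one_pow]
  have hkernel (i : Fin 11) : 0 ≤ ∑ j ∈ Finset.univ.erase i, ∑ k ∈ Finset.univ.erase i,
      kernel ⟪x i, x j⟫ ⟪x i, x k⟫ ⟪x j, x k⟫ := by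
    simp only [kernel, Finset.sum_add_distrib, ← Finset.sum_mul_sum]
    exact add_nonneg (mul_self_nonneg _)
      (sum_mul_projected_inner_nonneg _ x (x i) (hx i) fun j => linWeight ⟪x i, x j⟫)
  have hframe : 0 ≤ ∑ i, ∑ j ∈ Finset.univ.erase i, (⟪x i, x j⟫ ^ 2 - 3 / 25 : ℝ) := by
    have h := sq_card_le_mul_sum_sq_inner x hx
    have hsplit (i : Fin 11) : ∑ j ∈ Finset.univ.erase i, (⟪x i, x j⟫ ^ 2 - 3 / 25 : ℝ)
        = ∑ j, ⟪x i, x j⟫ ^ 2 - 11 / 5 := by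
      rw [← Finset.sum_erase_add _ _ (Finset.mem_univ i), hself, Finset.sum_sub_distrib,
        Finset.sum_const, hcard]
      norm_num
      ring
    simp only [hsplit, Finset.sum_sub_distrib]
    norm_num at h ⊢
    linarith
  have hsum : (tripleSum fun i j k => tripleKernel ⟪x i, x j⟫ ⟪x i, x k⟫ ⟪x j, x k⟫)
      = ∑ i, ∑ j ∈ Finset.univ.erase i, ∑ k ∈ Finset.univ.erase i,
          kernel ⟪x i, x j⟫ ⟪x i, x k⟫ ⟪x j, x k⟫
        + 3 / 2 * ∑ i, ∑ j ∈ Finset.univ.erase i, (⟪x i, x j⟫ ^ 2 - 3 / 25 : ℝ) := by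
    rw [← sum_erase_eq_tripleSum, Finset.mul_sum, ← Finset.sum_add_distrib]
    refine Finset.sum_congr rfl fun i _ => ?_
    rw [sum_sum_eq_sum_sum_erase (hcard i) (by norm_num), Finset.mul_sum,
      ← Finset.sum_add_distrib]
    refine Finset.sum_congr rfl fun j hj => ?_
    simp only [tripleKernel, hself]
    rw [Finset.sum_add_distrib, Finset.sum_const, Finset.card_erase_of_mem hj, hcard]
    norm_num
    ring
  rw [hsum]
  exact add_nonneg (Finset.sum_nonneg fun i _ => hkernel i) (by positivity)

theorem cos_le_of_angle : Real.cos (85.39 * π / 180) ≤ 161 / 2000 := by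
  have hπ := Real.pi_lt_d4
  rw [← Real.sin_pi_div_two_sub]
  refine (Real.sin_le ?_).trans ?_
  · linarith [Real.pi_pos]
  · linarith

/-- Any 11 distinct unit vectors in ℝ^5 contain a pair at angular distance
at most 85.39 degrees. -/
theorem sphere_code_dim5_N11 (x : Fin 11 → EuclideanSpace ℝ (Fin 5))
    (hx : ∀ i, ‖x i‖ = 1) (hinj : Function.Injective x) :
    ∃ i j, i ≠ j ∧ ⟪x i, x j⟫ ≥ Real.cos (85.39 * π / 180) := by
  by_contra! h
  have hle {i j : Fin 11} (hij : i ≠ j) : ⟪x i, x j⟫ ≤ (161 / 2000 : ℝ) :=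
    (h i j hij).le.trans cos_le_of_angle
  have hge (i j : Fin 11) : -1 ≤ ⟪x i, x j⟫ := by
    have := neg_le_of_abs_le (abs_real_inner_le_norm (x i) (x j))
    simpa [hx] using this
  refine (tripleSum_tripleKernel_nonneg x hx).not_gt
    (tripleSum_neg (by simp) fun i j k hij hjk hki => ?_)
  rw [real_inner_comm (x i) (x j), real_inner_comm (x i) (x k), real_inner_comm (x j) (x k)]
  exact tripleKernel_cyclic_sum_neg (hge i j) (hge i k) (hge j k) (hle hij) (hle hki.symm)
    (hle hjk)
end
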